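/- Let G be an internally triangulated plane graph with an extensible canonical ordering v1,…,vi for G_i. A vertex v ∈ V∖V_i is eligible for G_i if and only if R_i(v) ∩ V = ∅, if and only if R_i(v) ∩ 𝓔_i = ∅, where 𝓔_i is the set of vertices eligible for G_i. -/

import Mathlib

open Set Bornology

noncomputable section

/-! ### Plane drawings, planarity, and triangulations

A drawing of a simple graph in the plane: vertices are distinct points, edges are
simple continuous curves between their endpoints, interiors of edges avoid vertices,
and distinct edges have disjoint interiors (no two edges cross or touch). -/

structure PlaneDrawing {V : Type} (G : SimpleGraph V) where
  vert : V → ℝ × ℝ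
  edge : Sym2 V → ℝ → ℝ × ℝ
  vert_inj : Function.Injective vert
  edge_cont : ∀ e ∈ G.edgeSet, ContinuousOn (edge e) (Set.Icc 0 1)
  edge_injOn : ∀ e ∈ G.edgeSet, Set.InjOn (edge e) (Set.Icc 0 1)
  edge_ends : ∀ a b : V, G.Adj a b →
    ({edge s(a, b) 0, edge s(a, b) 1} : Set (ℝ × ℝ)) = {vert a, vert b}
  edge_int_vert : ∀ e ∈ G.edgeSet, ∀ x : V, vert x ∉ edge e '' Set.Ioo 0 1
  edge_disjoint : ∀ e ∈ G.edgeSet, ∀ f ∈ G.edgeSet, e ≠ f →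
    edge e '' Set.Ioo 0 1 ∩ edge f '' Set.Ioo 0 1 = ∅

/-- A graph is planar if it admits a crossing-free drawing in the plane. -/
def IsPlanar {V : Type} (G : SimpleGraph V) : Prop := Nonempty (PlaneDrawing G)

/-- A (plane) triangulation: a maximal planar graph on at least three vertices. -/
def IsTriangulation {V : Type} [Fintype V] (G : SimpleGraph V) : Prop :=
  3 ≤ Fintype.card V ∧ IsPlanar G ∧
    ∀ a b : V, a ≠ b → ¬ G.Adj a b →
      ¬ IsPlanar (G ⊔ SimpleGraph.fromEdgeSet {s(a, b)})

/-- The edges of `G` with both endpoints in `W`. -/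
def edgesWithin {V : Type} (G : SimpleGraph V) (W : Set V) : Set (Sym2 V) :=
  {e | e ∈ G.edgeSet ∧ ∀ x ∈ e, x ∈ W}

/-- The neighbours of `x` that lie in `W`. -/
def nbrsIn {V : Type} (G : SimpleGraph V) (W : Set V) (x : V) : Set V :=
  {y | y ∈ W ∧ G.Adj x y}

namespace PlaneDrawing

variable {V : Type} {G : SimpleGraph V}

def edgeImage (D : PlaneDrawing G) (e : Sym2 V) : Set (ℝ × ℝ) :=
  D.edge e '' Set.Icc 0 1

/-- The union of all vertex points and edge curves of the sub-drawing induced by `W`. -/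
def imageOn (D : PlaneDrawing G) (W : Set V) : Set (ℝ × ℝ) :=
  D.vert '' W ∪ ⋃ e ∈ edgesWithin G W, D.edgeImage e

/-- The outer face `F∘` of the sub-drawing induced by `W`: the union of the unbounded
connected components of the complement of the drawing. -/
def outerRegion (D : PlaneDrawing G) (W : Set V) : Set (ℝ × ℝ) :=
  {p | p ∉ D.imageOn W ∧ ¬ IsBounded (connectedComponentIn (D.imageOn W)ᶜ p)}

/-- The vertex `x` lies on the boundary cycle `C∘` of the outer face of `G[W]`. -/
def OnOuterVertex (D : PlaneDrawing G) (W : Set V) (x : V) : Prop :=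
  D.vert x ∈ frontier (D.outerRegion W)

/-- The edge `e` lies on the boundary cycle `C∘` of the outer face of `G[W]`. -/
def OnOuterEdge (D : PlaneDrawing G) (W : Set V) (e : Sym2 V) : Prop :=
  e ∈ edgesWithin G W ∧ D.edgeImage e ⊆ frontier (D.outerRegion W)

/-- The triangle `abc` bounds a face of the full drawing. -/
def IsFacialTriangle (D : PlaneDrawing G) (a b c : V) : Prop :=
  G.Adj a b ∧ G.Adj b c ∧ G.Adj a c ∧
    ∃ p, p ∉ D.imageOn Set.univ ∧
      frontier (connectedComponentIn (D.imageOn Set.univ)ᶜ p) =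
        D.edgeImage s(a, b) ∪ D.edgeImage s(b, c) ∪ D.edgeImage s(a, c)

/-- Every inner (bounded) face of the sub-drawing induced by `W` is bounded by a
triangle of `G[W]`. -/
def InnerFacesTriangulated (D : PlaneDrawing G) (W : Set V) : Prop :=
  ∀ p, p ∉ D.imageOn W → IsBounded (connectedComponentIn (D.imageOn W)ᶜ p) →
    ∃ a ∈ W, ∃ b ∈ W, ∃ c ∈ W, G.Adj a b ∧ G.Adj b c ∧ G.Adj a c ∧
      frontier (connectedComponentIn (D.imageOn W)ᶜ p) =
        D.edgeImage s(a, b) ∪ D.edgeImage s(b, c) ∪ D.edgeImage s(a, c)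

end PlaneDrawing

/-- A graph is biconnected if it is connected and has no cut vertex. -/
def Biconnected {α : Type} (H : SimpleGraph α) : Prop :=
  H.Connected ∧ ∀ x : α, (H.induce {y | y ≠ x}).Connected

/-- The subgraph of `G` induced by `W` (with the drawing `D`) is internally
triangulated: biconnected and every inner face is a triangle. -/
def InternallyTriangulatedOn {V : Type} {G : SimpleGraph V}
    (D : PlaneDrawing G) (W : Set V) : Prop :=
  Biconnected (G.induce W) ∧ D.InnerFacesTriangulated W

/-! ### Canonical orderings -/

/-- The vertex set `V_i = {v 1, …, v i}`. -/
def Vset {V : Type} (v : ℕ → V) (i : ℕ) : Set V := v '' Set.Icc 1 i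

/-- `v 1, …, v i` is a canonical ordering for `G_i` (conditions (C1)–(C3)). -/
def IsCanonicalOrdering {V : Type} {G : SimpleGraph V} (D : PlaneDrawing G)
    (i : ℕ) (v : ℕ → V) : Prop :=
  3 ≤ i ∧ Set.InjOn v (Set.Icc 1 i) ∧ G.Adj (v 1) (v 2) ∧
    ∀ m, 3 ≤ m → m ≤ i →
      InternallyTriangulatedOn D (Vset v m) ∧
      D.OnOuterEdge (Vset v m) s(v 1, v 2) ∧
      ∀ j, m < j → j ≤ i → D.vert (v j) ∈ D.outerRegion (Vset v m)

/-- The canonical ordering `v 1, …, v i` is extensible: it can be completed to a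
canonical ordering of the whole graph. -/
def ExtensibleOrd {V : Type} [Fintype V] {G : SimpleGraph V} (D : PlaneDrawing G)
    (i : ℕ) (v : ℕ → V) : Prop :=
  ∃ w : ℕ → V, (∀ m, 1 ≤ m → m ≤ i → w m = v m) ∧
    Set.BijOn w (Set.Icc 1 (Fintype.card V)) Set.univ ∧
    IsCanonicalOrdering D (Fintype.card V) w

/-- Append `x` to the sequence `v` at position `i + 1`. -/
def extendSeq {V : Type} (v : ℕ → V) (i : ℕ) (x : V) : ℕ → V :=
  fun m => if m = i + 1 then x else v m

/-- A vertex `x ∉ V_i` is eligible for `G_i` if appending it yields an extensible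
canonical ordering for `G_{i+1}`. -/
def Eligible {V : Type} [Fintype V] {G : SimpleGraph V} (D : PlaneDrawing G)
    (i : ℕ) (v : ℕ → V) (x : V) : Prop :=
  x ∉ Vset v i ∧ IsCanonicalOrdering D (i + 1) (extendSeq v i x) ∧
    ExtensibleOrd D (i + 1) (extendSeq v i x)

open Classical in
/-- The region `R_i(x)` associated to a vertex `x ∉ W` (with `W = V_i`): the outer
face of `G[W]` if `x` has at most one neighbour in `W`, and otherwise the part of the
outer face cut off from infinity by the edges from `x` to its neighbours on the
outer path. -/
def Rregion {V : Type} {G : SimpleGraph V} (D : PlaneDrawing G)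
    (W : Set V) (x : V) : Set (ℝ × ℝ) :=
  if (nbrsIn G W x).Subsingleton then D.outerRegion W
  else
    {p | p ∈ D.outerRegion W ∧
      p ∉ (⋃ y ∈ nbrsIn G W x, D.edgeImage s(x, y)) ∧
      IsBounded (connectedComponentIn
        (D.imageOn W ∪ ⋃ y ∈ nbrsIn G W x, D.edgeImage s(x, y))ᶜ p)}

/-- The open region `X_j` spanned by `u` and the part of the outer path between two
consecutive neighbours `a`, `b` of `u`. -/
def Xregion {V : Type} {G : SimpleGraph V} (D : PlaneDrawing G)
    (W : Set V) (u a b : V) : Set (ℝ × ℝ) :=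
  {p | p ∈ D.outerRegion W ∧
    p ∉ D.edgeImage s(u, a) ∪ D.edgeImage s(u, b) ∧
    IsBounded (connectedComponentIn
      (D.imageOn W ∪ D.edgeImage s(u, a) ∪ D.edgeImage s(u, b))ᶜ p)}

/-! ### Arc diagrams

Vertices are placed on a horizontal spine.  Every edge is drawn as a *mountain*
(a proper arc, i.e. halfcircle, above the spine), a *pocket* (a proper arc below the
spine), or a *down-up biarc* (two halfcircles, crossing the spine exactly once, the
left halfcircle below and the right halfcircle above the spine).  In particular all
edges are x-monotone and every biarc is down-up monotone.  Each edge also carries an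
amount of credits (used only for the credit-scheme lemmas). -/

inductive ArcKind : Type
  | mountain
  | pocket
  | biarc
deriving DecidableEq

structure ArcDiagram (V : Type) where
  pos : V → ℝ
  kind : Sym2 V → ArcKind
  crossPt : Sym2 V → ℝ
  credit : Sym2 V → ℝ

/-- Two intervals interleave (so that halfcircles over them on the same side of the
spine cross). -/
def Interleaved (p q : ℝ × ℝ) : Prop := p.1 < q.1 ∧ q.1 < p.2 ∧ p.2 < q.2

/-- The height above (or depth below) the spine, at abscissa `x`, of the halfcircle
with diameter from `l` to `r` centered on the spine. -/
def arcHeight (l r x : ℝ) : ℝ := Real.sqrt (((r - l) / 2) ^ 2 - (x - (l + r) / 2) ^ 2)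

namespace ArcDiagram

variable {V : Type}

def lo (A : ArcDiagram V) (e : Sym2 V) : ℝ :=
  Sym2.lift ⟨fun a b => min (A.pos a) (A.pos b), fun _ _ => min_comm _ _⟩ e

def hi (A : ArcDiagram V) (e : Sym2 V) : ℝ :=
  Sym2.lift ⟨fun a b => max (A.pos a) (A.pos b), fun _ _ => max_comm _ _⟩ e

/-- The halfcircles of the edge `e` above the spine (as intervals on the spine). -/
def upperArcs (A : ArcDiagram V) (e : Sym2 V) : List (ℝ × ℝ) :=
  match A.kind e with
  | ArcKind.mountain => [(A.lo e, A.hi e)]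
  | ArcKind.pocket => []
  | ArcKind.biarc => [(A.crossPt e, A.hi e)]

/-- The halfcircles of the edge `e` below the spine (as intervals on the spine). -/
def lowerArcs (A : ArcDiagram V) (e : Sym2 V) : List (ℝ × ℝ) :=
  match A.kind e with
  | ArcKind.mountain => []
  | ArcKind.pocket => [(A.lo e, A.hi e)]
  | ArcKind.biarc => [(A.lo e, A.crossPt e)]

/-- `A` is a plane arc diagram of the subgraph of `G` induced by `W`: vertex
positions on the spine are distinct, spine crossings of biarcs are in the interior
of the edge's span and distinct from all vertices and from each other, and no two
halfcircles on the same side of the spine cross. -/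
def IsPlaneOn (A : ArcDiagram V) (G : SimpleGraph V) (W : Set V) : Prop :=
  Set.InjOn A.pos W ∧
  (∀ e ∈ edgesWithin G W, A.kind e = ArcKind.biarc →
      A.lo e < A.crossPt e ∧ A.crossPt e < A.hi e ∧ ∀ x ∈ W, A.crossPt e ≠ A.pos x) ∧
  (∀ e ∈ edgesWithin G W, ∀ f ∈ edgesWithin G W, e ≠ f →
      A.kind e = ArcKind.biarc → A.kind f = ArcKind.biarc → A.crossPt e ≠ A.crossPt f) ∧
  (∀ e ∈ edgesWithin G W, ∀ f ∈ edgesWithin G W, e ≠ f →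
      (∀ p ∈ A.upperArcs e, ∀ q ∈ A.upperArcs f, ¬ Interleaved p q) ∧
      (∀ p ∈ A.lowerArcs e, ∀ q ∈ A.lowerArcs f, ¬ Interleaved p q))

/-- The number of biarcs of the diagram (on the subgraph induced by `W`). -/
def biarcCount (A : ArcDiagram V) (G : SimpleGraph V) (W : Set V) : ℕ :=
  {e | e ∈ edgesWithin G W ∧ A.kind e = ArcKind.biarc}.ncard

/-- The cost of the diagram: the total amount of credits on its edges. -/
def cost (A : ArcDiagram V) (G : SimpleGraph V) (W : Set V) : ℝ :=
  ∑ᶠ e ∈ edgesWithin G W, A.credit e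

/-- The edge `e` is (partly) vertically visible from above. -/
def OnUpperEnvelope (A : ArcDiagram V) (G : SimpleGraph V) (W : Set V)
    (e : Sym2 V) : Prop :=
  e ∈ edgesWithin G W ∧ ∃ p ∈ A.upperArcs e, ∃ x : ℝ, p.1 < x ∧ x < p.2 ∧
    ∀ f ∈ edgesWithin G W, f ≠ e → ∀ q ∈ A.upperArcs f, q.1 < x → x < q.2 →
      arcHeight q.1 q.2 x < arcHeight p.1 p.2 x

/-- The edge `e` is (partly) vertically visible from below. -/
def OnLowerEnvelope (A : ArcDiagram V) (G : SimpleGraph V) (W : Set V)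
    (e : Sym2 V) : Prop :=
  e ∈ edgesWithin G W ∧ ∃ p ∈ A.lowerArcs e, ∃ x : ℝ, p.1 < x ∧ x < p.2 ∧
    ∀ f ∈ edgesWithin G W, f ≠ e → ∀ q ∈ A.lowerArcs f, q.1 < x → x < q.2 →
      arcHeight q.1 q.2 x < arcHeight p.1 p.2 x

end ArcDiagram

/-! ### The invariants (I1)–(I5) of valid resp. extensible arc diagrams -/

/-- Invariants (I1)–(I4): `A` is a valid arc diagram for the subgraph of `G` induced
by `W` (relative to the plane embedding `D` of `G`, the starting vertices `v1, v2`,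
and the constant `χ`).  (I1) every edge is a proper arc or a down-up biarc and every
edge on the upper envelope is a proper arc; (I2) every mountain whose left endpoint
lies on `C∘(G[W]) \ {v2}` carries one credit; (I3) every biarc carries one credit;
(I4) every pocket on `P∘(G[W])` carries `χ` credits. -/
def ValidDiagram {V : Type} {G : SimpleGraph V} (D : PlaneDrawing G)
    (W : Set V) (v1 v2 : V) (χ : ℝ) (A : ArcDiagram V) : Prop :=
  A.IsPlaneOn G W ∧
  (∀ e ∈ edgesWithin G W, 0 ≤ A.credit e) ∧
  (∀ e, A.OnUpperEnvelope G W e → A.kind e ≠ ArcKind.biarc) ∧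
  (∀ a b : V, a ∈ W → b ∈ W → G.Adj a b → A.kind s(a, b) = ArcKind.mountain →
      A.pos a < A.pos b → D.OnOuterVertex W a → a ≠ v2 → 1 ≤ A.credit s(a, b)) ∧
  (∀ e ∈ edgesWithin G W, A.kind e = ArcKind.biarc → 1 ≤ A.credit e) ∧
  (∀ e ∈ edgesWithin G W, A.kind e = ArcKind.pocket → D.OnOuterEdge W e →
      e ≠ s(v1, v2) → χ ≤ A.credit e)

/-- Invariants (I1)–(I5): additionally `v1` is leftmost and `v2` rightmost on the
spine, the edge `v1 v2` forms the lower envelope, and the edges of `P∘(G[W])` form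
the upper envelope. -/
def ExtensibleDiagram {V : Type} {G : SimpleGraph V} (D : PlaneDrawing G)
    (W : Set V) (v1 v2 : V) (χ : ℝ) (A : ArcDiagram V) : Prop :=
  ValidDiagram D W v1 v2 χ A ∧ v1 ∈ W ∧ v2 ∈ W ∧
  (∀ w ∈ W, w ≠ v1 → A.pos v1 < A.pos w) ∧
  (∀ w ∈ W, w ≠ v2 → A.pos w < A.pos v2) ∧
  (∀ e ∈ edgesWithin G W, (A.OnLowerEnvelope G W e ↔ e = s(v1, v2))) ∧
  (∀ e ∈ edgesWithin G W, (A.OnUpperEnvelope G W e ↔ D.OnOuterEdge W e ∧ e ≠ s(v1, v2)))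

/-! ### Profiles, problematic vertices, pivots and the covering relation -/

/-- `x` has type `T(2, ⌢)`: degree two in `G_{i+1}` and its profile is a single
mountain. -/
def TypeT2 {V : Type} (A : ArcDiagram V) (G : SimpleGraph V) (W : Set V)
    (x : V) : Prop :=
  ∃ a b : V, nbrsIn G W x = {a, b} ∧ A.pos a < A.pos b ∧ G.Adj a b ∧
    A.kind s(a, b) = ArcKind.mountain

/-- `x` has type `T(3, ⌢⌢)`. -/
def TypeT3mm {V : Type} (A : ArcDiagram V) (G : SimpleGraph V) (W : Set V)
    (x : V) : Prop :=
  ∃ a b c : V, nbrsIn G W x = {a, b, c} ∧ A.pos a < A.pos b ∧ A.pos b < A.pos c ∧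
    G.Adj a b ∧ G.Adj b c ∧
    A.kind s(a, b) = ArcKind.mountain ∧ A.kind s(b, c) = ArcKind.mountain

/-- `x` has type `T(4, ⌢⌢⌢)`. -/
def TypeT4 {V : Type} (A : ArcDiagram V) (G : SimpleGraph V) (W : Set V)
    (x : V) : Prop :=
  ∃ a b c d : V, nbrsIn G W x = {a, b, c, d} ∧
    A.pos a < A.pos b ∧ A.pos b < A.pos c ∧ A.pos c < A.pos d ∧
    G.Adj a b ∧ G.Adj b c ∧ G.Adj c d ∧
    A.kind s(a, b) = ArcKind.mountain ∧ A.kind s(b, c) = ArcKind.mountain ∧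
    A.kind s(c, d) = ArcKind.mountain

/-- `x` has type `T(3, ⌢⌣)`. -/
def TypeT3ms {V : Type} (A : ArcDiagram V) (G : SimpleGraph V) (W : Set V)
    (x : V) : Prop :=
  ∃ a b c : V, nbrsIn G W x = {a, b, c} ∧ A.pos a < A.pos b ∧ A.pos b < A.pos c ∧
    G.Adj a b ∧ G.Adj b c ∧
    A.kind s(a, b) = ArcKind.mountain ∧ A.kind s(b, c) = ArcKind.pocket

/-- An eligible vertex is problematic if it has one of the four types
`T(2,⌢)`, `T(3,⌢⌢)`, `T(4,⌢⌢⌢)`, `T(3,⌢⌣)`. -/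
def Problematic {V : Type} (A : ArcDiagram V) (G : SimpleGraph V) (W : Set V)
    (x : V) : Prop :=
  TypeT2 A G W x ∨ TypeT3mm A G W x ∨ TypeT4 A G W x ∨ TypeT3ms A G W x

def HasLeftPivotType {V : Type} (A : ArcDiagram V) (G : SimpleGraph V) (W : Set V)
    (x : V) : Prop :=
  TypeT2 A G W x ∨ TypeT3mm A G W x ∨ TypeT4 A G W x

def HasRightPivotType {V : Type} (A : ArcDiagram V) (G : SimpleGraph V) (W : Set V)
    (x : V) : Prop :=
  TypeT3ms A G W x

def IsLeftmostNbr {V : Type} (A : ArcDiagram V) (G : SimpleGraph V) (W : Set V)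
    (x l : V) : Prop :=
  l ∈ nbrsIn G W x ∧ ∀ y ∈ nbrsIn G W x, A.pos l ≤ A.pos y

def IsRightmostNbr {V : Type} (A : ArcDiagram V) (G : SimpleGraph V) (W : Set V)
    (x r : V) : Prop :=
  r ∈ nbrsIn G W x ∧ ∀ y ∈ nbrsIn G W x, A.pos y ≤ A.pos r

/-- `q` is the pivot `p(x)` of the problematic vertex `x`: its rightmost neighbour on
the outer path if `x` has right pivot type `T(3,⌢⌣)`, its leftmost neighbour
otherwise. -/
def IsPivot {V : Type} (A : ArcDiagram V) (G : SimpleGraph V) (W : Set V)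
    (x q : V) : Prop :=
  (HasRightPivotType A G W x ∧ IsRightmostNbr A G W x q) ∨
  (HasLeftPivotType A G W x ∧ IsLeftmostNbr A G W x q)

/-- `z = pc(x)`: the vertex covering the pivot edge `x·p(x)`, i.e. the vertex outside
`W ∪ {x}` forming a triangular face of `G` with this edge. -/
def PivotCover {V : Type} {G : SimpleGraph V} (D : PlaneDrawing G) (A : ArcDiagram V)
    (W : Set V) (x z : V) : Prop :=
  z ∉ W ∧ z ≠ x ∧ ∃ q : V, IsPivot A G W x q ∧ D.IsFacialTriangle x q z

/-- `z` covers the edge `e` of the outer path: `z ∉ W` forms a triangular face of `G`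
with the two endpoints of `e`. -/
def CoversEdge {V : Type} {G : SimpleGraph V} (D : PlaneDrawing G)
    (W : Set V) (z : V) (e : Sym2 V) : Prop :=
  z ∉ W ∧ ∃ a b : V, e = s(a, b) ∧ D.IsFacialTriangle a b z

/-- `a` and `b` are consecutive neighbours (from left to right) of `x` in `W`. -/
def ConsecNbrs {V : Type} (A : ArcDiagram V) (G : SimpleGraph V) (W : Set V)
    (x a b : V) : Prop :=
  a ∈ nbrsIn G W x ∧ b ∈ nbrsIn G W x ∧ A.pos a < A.pos b ∧
    ∀ c ∈ nbrsIn G W x, ¬ (A.pos a < A.pos c ∧ A.pos c < A.pos b)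

/-- `e` is an edge of the profile `pr(x)`: an edge of the outer path between two
consecutive neighbours of `x`. -/
def ProfileEdge {V : Type} (A : ArcDiagram V) (G : SimpleGraph V) (W : Set V)
    (x : V) (e : Sym2 V) : Prop :=
  ∃ a b : V, e = s(a, b) ∧ ConsecNbrs A G W x a b ∧ G.Adj a b

/-! ### Construction sequences of planar 3-trees and their dual face trees -/

/-- A construction sequence of a planar 3-tree `G`: starting from the triangle on the
first three vertices, each subsequent vertex `ord j` is inserted into a face `F j`
(a triangle of three earlier vertices that was created earlier and not yet
subdivided) and joined to its three vertices. -/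
structure P3TConstruction (V : Type) [Fintype V] [DecidableEq V]
    (G : SimpleGraph V) where
  n : ℕ
  three_le : 3 ≤ n
  card_eq : Fintype.card V = n
  ord : Fin n ≃ V
  F : Fin n → Finset V
  adj_base : ∀ i j : Fin n, (i : ℕ) < 3 → (j : ℕ) < 3 → (G.Adj (ord i) (ord j) ↔ i ≠ j)
  adj_ins : ∀ j : Fin n, 3 ≤ (j : ℕ) → ∀ i : Fin n, i < j →
    (G.Adj (ord i) (ord j) ↔ ord i ∈ F j)
  F_card : ∀ j : Fin n, 3 ≤ (j : ℕ) → (F j).card = 3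
  F_sub : ∀ j : Fin n, 3 ≤ (j : ℕ) → ∀ u ∈ F j, ∃ i : Fin n, i < j ∧ ord i = u
  F_inj : ∀ j k : Fin n, 3 ≤ (j : ℕ) → 3 ≤ (k : ℕ) → F j = F k → j = k
  F_created : ∀ j : Fin n, 3 ≤ (j : ℕ) →
    F j = {ord ⟨0, Nat.lt_of_lt_of_le (by norm_num) three_le⟩,
           ord ⟨1, Nat.lt_of_lt_of_le (by norm_num) three_le⟩,
           ord ⟨2, Nat.lt_of_lt_of_le (by norm_num) three_le⟩} ∨
      ∃ i : Fin n, i < j ∧ 3 ≤ (i : ℕ) ∧ ∃ x ∈ F i, F j = insert (ord i) ((F i).erase x)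

namespace P3TConstruction

variable {V : Type} [Fintype V] [DecidableEq V] {G : SimpleGraph V}

/-- The root face `v1 v2 v3` of the dual face tree. -/
def rootFace (C : P3TConstruction V G) : Finset V :=
  {C.ord ⟨0, Nat.lt_of_lt_of_le (by norm_num) C.three_le⟩,
   C.ord ⟨1, Nat.lt_of_lt_of_le (by norm_num) C.three_le⟩,
   C.ord ⟨2, Nat.lt_of_lt_of_le (by norm_num) C.three_le⟩}

/-- The child face of `F j` obtained by replacing its vertex `x` with `ord j`. -/
def childFace (C : P3TConstruction V G) (j : Fin C.n) (x : V) : Finset V :=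
  insert (C.ord j) ((C.F j).erase x)

/-- A face is internal (has a face vertex, i.e. is subdivided at some point, i.e. is
active at some point) iff some vertex is inserted into it. -/
def IsInternalFace (C : P3TConstruction V G) (f : Finset V) : Prop :=
  ∃ j : Fin C.n, 3 ≤ (j : ℕ) ∧ C.F j = f

/-- `g` is a child of `f` in the dual face tree. -/
def IsChildOf (C : P3TConstruction V G) (g f : Finset V) : Prop :=
  ∃ j : Fin C.n, 3 ≤ (j : ℕ) ∧ C.F j = f ∧ ∃ x ∈ C.F j, g = C.childFace j x

/-- `f` is a node of the dual face tree `𝒯`. -/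
def IsFace (C : P3TConstruction V G) (f : Finset V) : Prop :=
  f = C.rootFace ∨ ∃ f' : Finset V, C.IsChildOf f f'

/-- The grand-degree of a face: the maximal number of active child faces over the
whole construction, i.e. the number of its internal (non-leaf) children in `𝒯`. -/
def gd (C : P3TConstruction V G) (f : Finset V) : ℕ :=
  {g : Finset V | C.IsChildOf g f ∧ C.IsInternalFace g}.ncard

end P3TConstruction

/-- `G` is a Kleetope over the sub-triangulation on the vertex set `S`: both `G` and
`G[S]` are plane triangulations, every vertex outside `S` has exactly the three
vertices of a triangle of `G[S]` as neighbours (so it is inserted into a face of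
`G[S]`), and the number of inserted vertices equals the number `2|S| - 4` of faces
of `G[S]` (so that exactly one vertex is inserted into each face). -/
def IsKleetopeOf {V : Type} [Fintype V] [DecidableEq V]
    (G : SimpleGraph V) (S : Finset V) : Prop :=
  IsTriangulation G ∧ IsTriangulation (G.induce (S : Set V)) ∧
    (∀ v : V, v ∉ S →
      (G.neighborSet v).ncard = 3 ∧ G.neighborSet v ⊆ (S : Set V) ∧
        ∀ a ∈ G.neighborSet v, ∀ b ∈ G.neighborSet v, a ≠ b → G.Adj a b) ∧
    Fintype.card V + 4 = 3 * S.card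

end

/-! ### Continuous logarithms and separation of the plane -/

theorem exists_continuous_exp_eq {E : Type*} [NormedAddCommGroup E] [NormedSpace ℝ E]
    {f : E → ℂ} (hf : Continuous f) (h0 : ∀ z, f z ≠ 0) :
    ∃ g : E → ℂ, Continuous g ∧ ∀ z, Complex.exp (g z) = f z := by
  obtain ⟨g, ⟨-, hg⟩, -⟩ := Complex.isCoveringMapOn_exp.existsUnique_continuousMap_lifts
    ⟨f, hf⟩ (a₀ := (0 : E)) (Complex.exp_log (h0 0)) h0
  exact ⟨g, g.continuous, fun z ↦ congrFun hg z⟩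

/-- Every continuous nonvanishing complex function on `K` has a continuous logarithm. -/
def HasContinuousLogs {X : Type*} [TopologicalSpace X] (K : Set X) : Prop :=
  ∀ f : X → ℂ, ContinuousOn f K → (∀ z ∈ K, f z ≠ 0) →
    ∃ g : X → ℂ, ContinuousOn g K ∧ ∀ z ∈ K, Complex.exp (g z) = f z

theorem ContinuousOn.exists_continuous_eqOn {X : Type*} [TopologicalSpace X] [NormalSpace X]
    {K : Set X} {g : X → ℂ} (hg : ContinuousOn g K) (hK : IsClosed K) :
    ∃ g' : X → ℂ, Continuous g' ∧ EqOn g' g K := by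
  obtain ⟨g', hg'⟩ := ContinuousMap.exists_restrict_eq hK
    (⟨fun z : K ↦ g z, hg.domRestrict⟩ : C(K, ℂ))
  exact ⟨g', g'.continuous, fun z hz ↦ congrArg (fun k : C(K, ℂ) ↦ k ⟨z, hz⟩) hg'⟩

theorem hasContinuousLogs_singleton {X : Type*} [TopologicalSpace X] (p : X) :
    HasContinuousLogs ({p} : Set X) := fun f _ h0 ↦
  ⟨fun _ ↦ Complex.log (f p), continuousOn_const, by
    rintro z rfl
    exact Complex.exp_log (h0 z rfl)⟩

theorem hasContinuousLogs_arc {X : Type*} [TopologicalSpace X] [T4Space X] {γ : ℝ → X}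
    (hc : ContinuousOn γ (Icc 0 1)) (hi : InjOn γ (Icc 0 1)) :
    HasContinuousLogs (γ '' Icc 0 1) := by
  intro f hf h0
  have h01 : (0 : ℝ) ≤ 1 := zero_le_one
  have hcomp : ContinuousOn (f ∘ γ) (Icc 0 1) := hf.comp hc (mapsTo_image _ _)
  obtain ⟨l, hl, hexp⟩ := exists_continuous_exp_eq (f := fun t : ℝ ↦ f (γ (projIcc 0 1 h01 t)))
    (hcomp.domRestrict.comp continuous_projIcc)
    (fun t ↦ h0 _ (mem_image_of_mem _ (projIcc 0 1 h01 t).2))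
  have he : Topology.IsClosedEmbedding (fun t : Icc (0 : ℝ) 1 ↦ γ t) :=
    Continuous.isClosedEmbedding hc.domRestrict (fun a b h ↦ Subtype.ext (hi a.2 b.2 h))
  obtain ⟨g, hg⟩ := ContinuousMap.exists_extension he
    (⟨fun t : Icc (0 : ℝ) 1 ↦ l t, hl.comp continuous_subtype_val⟩ : C(Icc (0 : ℝ) 1, ℂ))
  refine ⟨g, g.continuous.continuousOn, ?_⟩
  rintro _ ⟨t, ht, rfl⟩
  have h1 : g (γ t) = l t := congrArg (fun k : C(Icc (0 : ℝ) 1, ℂ) ↦ k ⟨t, ht⟩) hg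
  rw [h1, hexp t, projIcc_of_mem h01 ht]

theorem HasContinuousLogs.union {X : Type*} [TopologicalSpace X] {K A : Set X}
    (hK : HasContinuousLogs K) (hA : HasContinuousLogs A) (cK : IsClosed K) (cA : IsClosed A)
    (hKA : (K ∩ A).Subsingleton) : HasContinuousLogs (K ∪ A) := by
  classical
  intro f hf h0
  obtain ⟨k, hk, hkf⟩ := hK f (hf.mono subset_union_left) fun z hz ↦ h0 z (.inl hz)
  obtain ⟨a, ha, haf⟩ := hA f (hf.mono subset_union_right) fun z hz ↦ h0 z (.inr hz)
  obtain ⟨c, hc, hagree⟩ : ∃ c : ℂ, Complex.exp c = 1 ∧ ∀ z ∈ K ∩ A, k z = a z + c := by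
    rcases hKA.eq_empty_or_singleton with h | ⟨z, h⟩
    · exact ⟨0, by simp, by simp [h]⟩
    · have hz : z ∈ K ∩ A := h ▸ rfl
      refine ⟨k z - a z, ?_, ?_⟩
      · rw [Complex.exp_sub, hkf z hz.1, haf z hz.2, div_self (h0 z (.inl hz.1))]
      · rw [h]
        rintro _ rfl
        ring
  have eqK : EqOn (fun z ↦ if z ∈ K then k z else a z + c) k K := fun z hz ↦ by simp [hz]
  have eqA : EqOn (fun z ↦ if z ∈ K then k z else a z + c) (fun z ↦ a z + c) A := fun z hz ↦ by
    by_cases h : z ∈ K <;> simp [h]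
    exact hagree z ⟨h, hz⟩
  refine ⟨fun z ↦ if z ∈ K then k z else a z + c,
    (hk.congr eqK).union_of_isClosed ((ha.add continuousOn_const).congr eqA) cK cA, ?_⟩
  rintro z (hz | hz)
  · rw [eqK hz, hkf z hz]
  · rw [eqA hz, Complex.exp_add, haf z hz, hc, mul_one]

/-- A closed set with continuous logarithms does not contain the frontier of a bounded open set
reaching outside of it. -/
theorem HasContinuousLogs.not_isBounded {K C : Set (ℝ × ℝ)} (hK : HasContinuousLogs K)
    (cK : IsClosed K) (hfr : frontier C ⊆ K) {p : ℝ × ℝ} (hpC : p ∈ C) (hpK : p ∉ K) :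
    ¬ IsBounded C := by
  classical
  intro hb
  let φ : (ℝ × ℝ) ≃L[ℝ] ℂ := Complex.equivRealProdCLM.symm
  have hφ : Continuous fun z ↦ φ z - φ p := φ.continuous.sub continuous_const
  obtain ⟨g, hg, hgf⟩ := hK (fun z ↦ φ z - φ p) hφ.continuousOn fun z hz h ↦
    hpK (φ.injective (sub_eq_zero.mp h) ▸ hz)
  obtain ⟨g', hg', hgg'⟩ := hg.exists_continuous_eqOn cK
  obtain ⟨l, hl, hlf⟩ := exists_continuous_exp_eq
    (f := fun z ↦ if z ∈ C then Complex.exp (g' z) else φ z - φ p)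
    (Continuous.if (fun a ha ↦ by rw [hgg' (hfr ha), hgf a (hfr ha)])
      (Complex.continuous_exp.comp hg') hφ)
    (fun z ↦ by
      by_cases h : z ∈ C
      · simp [h, Complex.exp_ne_zero]
      · simp only [h, if_false]
        exact fun h' ↦ h (φ.injective (sub_eq_zero.mp h') ▸ hpC))
  obtain ⟨R, hR⟩ := ((φ.lipschitz.isBounded_image hb)).subset_closedBall (φ p)
  obtain ⟨S, hS0, hRS⟩ : ∃ S : ℝ, 0 < S ∧ R < S := ⟨max R 0 + 1, by positivity, by
    linarith [le_max_left R 0]⟩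
  let c : ℝ → ℝ × ℝ := fun t ↦ φ.symm (φ p + Complex.exp (Real.log S + t * Complex.I))
  have hc : Continuous c := φ.symm.continuous.comp (by fun_prop)
  have hcC : ∀ t, c t ∉ C := fun t ht ↦ by
    have h := hR (mem_image_of_mem φ ht)
    simp only [c, ContinuousLinearEquiv.apply_symm_apply, Metric.mem_closedBall, dist_eq_norm,
      add_sub_cancel_left, Complex.norm_exp] at h
    simp [Real.exp_log hS0] at h
    linarith
  have hlc : ∀ t, Complex.exp (l (c t)) = Complex.exp (Real.log S + t * Complex.I) := fun t ↦ by
    rw [hlf, if_neg (hcC t)]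
    simp [c]
  have key := Complex.isCoveringMap_exp.eq_of_comp_eq (A := ℝ) (g₁ := fun t : ℝ ↦ l (c t))
    (g₂ := fun t : ℝ ↦ l (c 0) + t * Complex.I) (hl.comp hc) (by fun_prop)
    (by
      ext t
      simp only [Function.comp, hlc, Complex.exp_add]
      simp) 0 (by simp)
  have h2 := congrFun key (2 * Real.pi)
  have hper : c (2 * Real.pi) = c 0 := by
    simp only [c, Complex.exp_add]
    simp
  simp [hper] at h2

/-! ### Connected components of the complement of a compact set -/

theorem IsPreconnected.inter_frontier_nonempty_of_mem {X : Type*} [TopologicalSpace X]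
    {S U : Set X} (hS : IsPreconnected S) (hU : IsOpen U) {p q : X} (hp : p ∈ S) (hpU : p ∈ U)
    (hq : q ∈ S) (hqU : q ∉ U) : (S ∩ frontier U).Nonempty := by
  by_contra hne
  have hcov : S ⊆ U ∪ (closure U)ᶜ := fun z hz ↦ by
    by_contra h
    simp only [mem_union, mem_compl_iff, not_or, not_not] at h
    exact hne ⟨z, hz, h.2, fun h' ↦ h.1 (interior_subset h')⟩
  obtain ⟨z, -, hzU, hz⟩ := hS U (closure U)ᶜ hU isClosed_closure.isOpen_compl hcov
    ⟨p, hp, hpU⟩ ⟨q, hq, (hcov hq).resolve_left hqU⟩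
  exact hz (subset_closure hzU)

theorem closure_connectedComponentIn_compl_subset {X : Type*} [TopologicalSpace X]
    [LocallyConnectedSpace X] {K : Set X} (hK : IsClosed K) (p : X) :
    closure (connectedComponentIn Kᶜ p) ⊆ connectedComponentIn Kᶜ p ∪ K := by
  intro q hq
  by_contra h
  simp only [mem_union, not_or] at h
  obtain ⟨z, hzq, hzp⟩ := mem_closure_iff.mp hq _ (hK.isOpen_compl.connectedComponentIn (x := q))
    (mem_connectedComponentIn h.2)
  exact h.1 (connectedComponentIn_eq hzp ▸ connectedComponentIn_eq hzq ▸
    mem_connectedComponentIn h.2)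

theorem frontier_connectedComponentIn_compl_subset {X : Type*} [TopologicalSpace X]
    [LocallyConnectedSpace X] {K : Set X} (hK : IsClosed K) (p : X) :
    frontier (connectedComponentIn Kᶜ p) ⊆ K := fun _ hq ↦
  (closure_connectedComponentIn_compl_subset hK p hq.1).resolve_left fun h ↦
    hq.2 ((hK.isOpen_compl.connectedComponentIn).interior_eq.symm ▸ h)

theorem isPreconnected_compl_closedBall_prod (r : ℝ) (hr : 0 ≤ r) :
    IsPreconnected (Metric.closedBall (0 : ℝ × ℝ) r)ᶜ := by
  have hrank : 1 < Module.rank ℝ (ℝ × ℝ) := by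
    simp [one_add_one_eq_two]
  have himage : (Metric.closedBall (0 : ℝ × ℝ) r)ᶜ =
      (fun q : ℝ × (ℝ × ℝ) ↦ q.1 • q.2) '' (Ioi r ×ˢ Metric.sphere (0 : ℝ × ℝ) 1) := by
    ext z
    simp only [mem_compl_iff, Metric.mem_closedBall, dist_zero_right, not_le, mem_image, mem_prod,
      mem_Ioi, mem_sphere_iff_norm, sub_zero]
    constructor
    · intro hz
      have hz0 : ‖z‖ ≠ 0 := (hr.trans_lt hz).ne'
      exact ⟨(‖z‖, ‖z‖⁻¹ • z), ⟨hz, by rw [norm_smul, norm_inv, norm_norm, inv_mul_cancel₀ hz0]⟩,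
        smul_inv_smul₀ hz0 z⟩
    · rintro ⟨⟨t, s⟩, ⟨ht, hs⟩, rfl⟩
      rw [norm_smul, hs, mul_one, Real.norm_eq_abs]
      exact ht.trans_le (le_abs_self t)
  rw [himage]
  exact (isPreconnected_Ioi.prod (isPreconnected_sphere hrank 0 1)).image _
    (continuous_fst.smul continuous_snd).continuousOn

theorem exists_unbounded_isPreconnected_compl {K : Set (ℝ × ℝ)} (hK : IsCompact K) :
    ∃ B ⊆ Kᶜ, IsPreconnected B ∧ IsBounded Bᶜ := by
  obtain ⟨r, hr⟩ := hK.isBounded.subset_closedBall 0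
  refine ⟨(Metric.closedBall (0 : ℝ × ℝ) (max r 0))ᶜ, ?_,
    isPreconnected_compl_closedBall_prod _ (le_max_right _ _), ?_⟩
  · exact compl_subset_compl.mpr (hr.trans (Metric.closedBall_subset_closedBall (le_max_left _ _)))
  · rw [compl_compl]
    exact Metric.isBounded_closedBall

theorem not_isBounded_univ_prod : ¬ IsBounded (univ : Set (ℝ × ℝ)) :=
  NormedSpace.unbounded_univ ℝ (ℝ × ℝ)

/-- The complement of a compact set in the plane has only one unbounded component. -/
theorem connectedComponentIn_compl_eq_of_unbounded {K : Set (ℝ × ℝ)} (hK : IsCompact K)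
    {p q : ℝ × ℝ} (hp : ¬ IsBounded (connectedComponentIn Kᶜ p))
    (hq : ¬ IsBounded (connectedComponentIn Kᶜ q)) :
    connectedComponentIn Kᶜ p = connectedComponentIn Kᶜ q := by
  obtain ⟨B, hBK, hB, hBb⟩ := exists_unbounded_isPreconnected_compl hK
  have main : ∀ z, ¬ IsBounded (connectedComponentIn Kᶜ z) → B ⊆ connectedComponentIn Kᶜ z := by
    intro z hz
    obtain ⟨y, hy, hyB⟩ : ∃ y ∈ connectedComponentIn Kᶜ z, y ∈ B := by
      by_contra! h
      exact hz (hBb.subset h)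
    rw [connectedComponentIn_eq hy]
    exact hB.subset_connectedComponentIn hyB hBK
  obtain ⟨b, hb⟩ : B.Nonempty := by
    by_contra h
    rw [not_nonempty_iff_eq_empty] at h
    exact not_isBounded_univ_prod (by simpa [h] using hBb)
  rw [connectedComponentIn_eq (main p hp hb), connectedComponentIn_eq (main q hq hb)]

theorem exists_unbounded_connectedComponentIn_compl {K : Set (ℝ × ℝ)} (hK : IsCompact K) :
    ∃ p ∉ K, ¬ IsBounded (connectedComponentIn Kᶜ p) := by
  obtain ⟨B, hBK, hB, hBb⟩ := exists_unbounded_isPreconnected_compl hK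
  have hBu : ¬ IsBounded B := fun h ↦ not_isBounded_univ_prod (by
    simpa using h.union hBb)
  obtain ⟨b, hb⟩ : B.Nonempty := by
    by_contra h
    rw [not_nonempty_iff_eq_empty] at h
    exact hBu (by simp [h])
  exact ⟨b, hBK hb, fun h ↦ hBu (h.subset (hB.subset_connectedComponentIn hb hBK))⟩

/-! ### Drawings of induced subgraphs and their outer regions -/

theorem nbrsIn_mono {V : Type} {G : SimpleGraph V} {W W' : Set V} (h : W ⊆ W') (x : V) :
    nbrsIn G W x ⊆ nbrsIn G W' x := fun _ hy ↦ ⟨h hy.1, hy.2⟩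

theorem edgesWithin_mono {V : Type} {G : SimpleGraph V} {W W' : Set V} (h : W ⊆ W') :
    edgesWithin G W ⊆ edgesWithin G W' := fun _ he ↦ ⟨he.1, fun x hx ↦ h (he.2 x hx)⟩

theorem mem_edgesWithin_mk {V : Type} {G : SimpleGraph V} {W : Set V} {a b : V} :
    s(a, b) ∈ edgesWithin G W ↔ G.Adj a b ∧ a ∈ W ∧ b ∈ W := by
  simp [edgesWithin]

namespace PlaneDrawing

variable {V : Type} {G : SimpleGraph V} (D : PlaneDrawing G)

/-- The edge curve without its endpoints. -/
def edgeInterior (e : Sym2 V) : Set (ℝ × ℝ) := D.edge e '' Ioo 0 1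

variable {D}

/-- An edge curve, parametrized from a given endpoint. -/
theorem exists_parametrization {a b : V} (hab : G.Adj a b) :
    ∃ γ : ℝ → ℝ × ℝ, ContinuousOn γ (Icc 0 1) ∧ γ 0 = D.vert a ∧ γ 1 = D.vert b ∧
      γ '' Ioo 0 1 = D.edgeInterior s(a, b) := by
  have hc := D.edge_cont s(a, b) hab
  have hends := D.edge_ends a b hab
  have hcases : (D.edge s(a, b) 0 = D.vert a ∧ D.edge s(a, b) 1 = D.vert b) ∨
      (D.edge s(a, b) 0 = D.vert b ∧ D.edge s(a, b) 1 = D.vert a) :=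
    Set.pair_eq_pair_iff.mp hends
  rcases hcases with ⟨h0, h1⟩ | ⟨h0, h1⟩
  · exact ⟨D.edge s(a, b), hc, h0, h1, rfl⟩
  · have hrev : (fun t : ℝ ↦ 1 - t) '' Ioo 0 1 = Ioo 0 1 := by simp
    refine ⟨fun t ↦ D.edge s(a, b) (1 - t), hc.comp (by fun_prop) fun t ht ↦ ?_, by simpa using h1,
      by simpa using h0, ?_⟩
    · exact ⟨by linarith [ht.2], by linarith [ht.1]⟩
    · exact (image_image (D.edge s(a, b)) (fun t ↦ 1 - t) (Ioo 0 1)).symm.trans (by rw [hrev]; rfl)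

theorem edgeImage_eq {a b : V} (hab : G.Adj a b) :
    D.edgeImage s(a, b) = D.edgeInterior s(a, b) ∪ {D.vert a, D.vert b} := by
  rw [edgeImage, edgeInterior, ← D.edge_ends a b hab,
    ← Ioo_union_both (zero_le_one : (0 : ℝ) ≤ 1), image_union, image_pair]

theorem edgeInterior_subset_edgeImage (e : Sym2 V) : D.edgeInterior e ⊆ D.edgeImage e :=
  image_mono Ioo_subset_Icc_self

theorem isCompact_edgeImage {e : Sym2 V} (he : e ∈ G.edgeSet) : IsCompact (D.edgeImage e) :=
  isCompact_Icc.image_of_continuousOn (D.edge_cont e he)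

theorem isPreconnected_insert_edgeInterior {a b : V} (hab : G.Adj a b) :
    IsPreconnected (insert (D.vert a) (D.edgeInterior s(a, b))) := by
  obtain ⟨γ, hγ, h0, -, htri⟩ := D.exists_parametrization hab
  rw [← h0, ← htri, ← image_insert_eq, Ioo_insert_left zero_lt_one]
  exact isPreconnected_Ico.image γ (hγ.mono Ico_subset_Icc_self)

theorem vert_left_mem_edgeImage {a b : V} (hab : G.Adj a b) :
    D.vert a ∈ D.edgeImage s(a, b) := by
  simp [D.edgeImage_eq hab]

theorem vert_right_mem_edgeImage {a b : V} (hab : G.Adj a b) :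
    D.vert b ∈ D.edgeImage s(a, b) := by
  simp [D.edgeImage_eq hab]

theorem edgeImage_subset_imageOn {W : Set V} {e : Sym2 V} (he : e ∈ edgesWithin G W) :
    D.edgeImage e ⊆ D.imageOn W := fun _ hp ↦ .inr (mem_biUnion he hp)

theorem imageOn_mono {W W' : Set V} (h : W ⊆ W') : D.imageOn W ⊆ D.imageOn W' :=
  union_subset_union (image_mono h) (biUnion_subset_biUnion_left (edgesWithin_mono h))

theorem mem_imageOn_iff {W : Set V} {p : ℝ × ℝ} :
    p ∈ D.imageOn W ↔ (∃ z ∈ W, D.vert z = p) ∨ ∃ e ∈ edgesWithin G W, p ∈ D.edgeInterior e := by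
  constructor
  · rintro (⟨z, hz, rfl⟩ | hp)
    · exact .inl ⟨z, hz, rfl⟩
    · obtain ⟨e, he, hp⟩ := mem_iUnion₂.mp hp
      induction e with | _ a b
      obtain ⟨hab, ha, hb⟩ := mem_edgesWithin_mk.mp he
      rw [D.edgeImage_eq hab] at hp
      rcases hp with hp | rfl | rfl
      exacts [.inr ⟨_, he, hp⟩, .inl ⟨a, ha, rfl⟩, .inl ⟨b, hb, rfl⟩]
  · rintro (⟨z, hz, rfl⟩ | ⟨e, he, hp⟩)
    · exact .inl ⟨z, hz, rfl⟩
    · exact edgeImage_subset_imageOn he (edgeInterior_subset_edgeImage e hp)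

theorem vert_mem_imageOn_iff {W : Set V} {z : V} : D.vert z ∈ D.imageOn W ↔ z ∈ W := by
  rw [mem_imageOn_iff]
  constructor
  · rintro (⟨y, hy, h⟩ | ⟨e, he, h⟩)
    · exact D.vert_inj h ▸ hy
    · exact absurd h (D.edge_int_vert e he.1 z)
  · exact fun h ↦ .inl ⟨z, h, rfl⟩

theorem notMem_imageOn_of_mem_edgeInterior {W : Set V} {e : Sym2 V} (he : e ∈ G.edgeSet)
    (heW : e ∉ edgesWithin G W) {p : ℝ × ℝ} (hp : p ∈ D.edgeInterior e) : p ∉ D.imageOn W := by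
  rw [mem_imageOn_iff]
  rintro (⟨z, -, rfl⟩ | ⟨f, hf, hpf⟩)
  · exact D.edge_int_vert e he z hp
  · have hne : e ≠ f := fun h ↦ heW (h ▸ hf)
    exact (D.edge_disjoint e he f hf.1 hne).subset ⟨hp, hpf⟩

theorem isCompact_imageOn [Finite V] (W : Set V) : IsCompact (D.imageOn W) :=
  (W.toFinite.image _).isCompact.union
    ((edgesWithin G W).toFinite.isCompact_biUnion fun _ he ↦ isCompact_edgeImage he.1)

theorem isClosed_imageOn [Finite V] (W : Set V) : IsClosed (D.imageOn W) :=
  (isCompact_imageOn W).isClosed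

theorem outerRegion_anti {W W' : Set V} (h : W ⊆ W') : D.outerRegion W' ⊆ D.outerRegion W :=
  fun p hp ↦ ⟨fun h' ↦ hp.1 (imageOn_mono h h'), fun hb ↦ hp.2 (hb.subset
    (connectedComponentIn_mono p (compl_subset_compl.mpr (imageOn_mono h))))⟩

/-- A vertex together with the interiors of its edges towards `W`. -/
def openStar (D : PlaneDrawing G) (W : Set V) (x : V) : Set (ℝ × ℝ) :=
  insert (D.vert x) (⋃ y ∈ nbrsIn G W x, D.edgeInterior s(x, y))

theorem isPreconnected_openStar (W : Set V) (x : V) : IsPreconnected (D.openStar W x) := by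
  have h : D.openStar W x = ⋃ y : Option (nbrsIn G W x), y.elim {D.vert x} fun y ↦
      insert (D.vert x) (D.edgeInterior s(x, y)) := by
    ext p
    simp only [openStar, iUnion_option, mem_insert_iff, mem_iUnion, mem_union, Option.elim,
      mem_singleton_iff, Subtype.exists, exists_prop]
    grind
  rw [h]
  refine isPreconnected_iUnion ⟨D.vert x, ?_⟩ ?_
  · rw [mem_iInter]
    rintro (_ | y) <;> simp
  · rintro (_ | y)
    · exact isPreconnected_singleton
    · exact isPreconnected_insert_edgeInterior y.2.2

theorem vert_mem_openStar (W : Set V) (x : V) : D.vert x ∈ D.openStar W x := mem_insert _ _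

theorem imageOn_insert (W : Set V) (x : V) :
    D.imageOn (insert x W) = D.imageOn W ∪ D.openStar W x := by
  ext p
  simp only [mem_union, mem_imageOn_iff, openStar, mem_insert_iff, mem_iUnion, exists_prop]
  constructor
  · rintro (⟨z, rfl | hz, rfl⟩ | ⟨e, he, hp⟩)
    · exact .inr (.inl rfl)
    · exact .inl (.inl ⟨z, hz, rfl⟩)
    · induction e with | _ a b
      obtain ⟨hab, ha, hb⟩ := mem_edgesWithin_mk.mp he
      rcases ha with rfl | ha <;> rcases hb with rfl | hb
      · exact absurd hab (G.irrefl)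
      · exact .inr (.inr ⟨b, ⟨hb, hab⟩, hp⟩)
      · exact .inr (.inr ⟨a, ⟨ha, hab.symm⟩, Sym2.eq_swap ▸ hp⟩)
      · exact .inl (.inr ⟨_, mem_edgesWithin_mk.mpr ⟨hab, ha, hb⟩, hp⟩)
  · rintro ((⟨z, hz, rfl⟩ | ⟨e, he, hp⟩) | rfl | ⟨y, hy, hp⟩)
    · exact .inl ⟨z, .inr hz, rfl⟩
    · exact .inr ⟨e, edgesWithin_mono (subset_insert x W) he, hp⟩
    · exact .inl ⟨x, .inl rfl, rfl⟩
    · exact .inr ⟨_, mem_edgesWithin_mk.mpr ⟨hy.2, .inl rfl, .inr hy.1⟩, hp⟩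

theorem disjoint_openStar_imageOn {W U : Set V} {x : V} (hx : x ∉ U) :
    Disjoint (D.openStar W x) (D.imageOn U) := by
  rw [Set.disjoint_left]
  intro p hp
  simp only [openStar, mem_insert_iff, mem_iUnion, exists_prop] at hp
  rcases hp with rfl | ⟨y, hy, hp⟩
  · rwa [vert_mem_imageOn_iff]
  · exact notMem_imageOn_of_mem_edgeInterior hy.2 (fun h ↦ hx (mem_edgesWithin_mk.mp h).2.1) hp

/-- An open star avoiding the drawing of `U` lies in a single face of it. -/
theorem openStar_subset_connectedComponentIn {W U : Set V} {x : V} (hx : x ∉ U) :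
    D.openStar W x ⊆ connectedComponentIn (D.imageOn U)ᶜ (D.vert x) :=
  (isPreconnected_openStar W x).subset_connectedComponentIn (vert_mem_openStar W x)
    (disjoint_openStar_imageOn hx).subset_compl_right

/-- The interior of an edge at a vertex outside of `U` lies in the same face of the drawing of `U`
as the vertex. -/
theorem edgeInterior_subset_connectedComponentIn {U : Set V} {a b : V} (hab : G.Adj a b)
    (ha : a ∉ U) :
    D.edgeInterior s(a, b) ⊆ connectedComponentIn (D.imageOn U)ᶜ (D.vert a) :=
  ((subset_biUnion_of_mem (u := fun y ↦ D.edgeInterior s(a, y))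
    (show b ∈ nbrsIn G univ a from ⟨trivial, hab⟩)).trans (subset_insert _ _)).trans
    (openStar_subset_connectedComponentIn ha)

/-- A drawn point of a face of the drawing of `W` lies on the open star of some vertex of
the face. -/
theorem exists_vert_mem_of_mem_imageOn_univ {W : Set V} {p q : ℝ × ℝ}
    (hq : q ∈ connectedComponentIn (D.imageOn W)ᶜ p) (hqu : q ∈ D.imageOn univ) :
    ∃ z, D.vert z ∈ connectedComponentIn (D.imageOn W)ᶜ p ∧
      (q = D.vert z ∨ ∃ b, G.Adj z b ∧ q ∈ D.edgeInterior s(z, b)) := by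
  rcases mem_imageOn_iff.mp hqu with ⟨z, -, rfl⟩ | ⟨e, he, hqe⟩
  · exact ⟨z, hq, .inl rfl⟩
  · induction e with | _ a b
    have hab : G.Adj a b := he.1
    have hqW : q ∉ D.imageOn W := connectedComponentIn_subset _ _ hq
    have main : ∀ {a b : V}, G.Adj a b → q ∈ D.edgeInterior s(a, b) → a ∉ W →
        D.vert a ∈ connectedComponentIn (D.imageOn W)ᶜ p := by
      intro a b hab hqe ha
      rw [connectedComponentIn_eq hq,
        ← connectedComponentIn_eq (edgeInterior_subset_connectedComponentIn hab ha hqe)]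
      exact mem_connectedComponentIn (by rwa [mem_compl_iff, vert_mem_imageOn_iff])
    by_cases ha : a ∈ W
    · have hb : b ∉ W := fun hb ↦ hqW (edgeImage_subset_imageOn
        (mem_edgesWithin_mk.mpr ⟨hab, ha, hb⟩) (edgeInterior_subset_edgeImage _ hqe))
      rw [Sym2.eq_swap] at hqe
      exact ⟨b, main hab.symm hqe hb, .inr ⟨a, hab.symm, hqe⟩⟩
    · exact ⟨a, main hab hqe ha, .inr ⟨b, hab, hqe⟩⟩

/-- If all vertices outside of `W` lie in the outer face of `G[W]`, then the inner faces of `G[W]`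
are inner faces of `G`. -/
theorem InnerFacesTriangulated.of_forall_mem_outerRegion [Finite V] {W : Set V}
    (hD : D.InnerFacesTriangulated univ) (hW : ∀ z ∉ W, D.vert z ∈ D.outerRegion W) :
    D.InnerFacesTriangulated W := by
  intro p hp hb
  have hdisj : connectedComponentIn (D.imageOn W)ᶜ p ⊆ (D.imageOn univ)ᶜ := by
    intro q hq hqu
    obtain ⟨z, hz, -⟩ := exists_vert_mem_of_mem_imageOn_univ hq hqu
    have hzW : z ∉ W := fun h ↦ connectedComponentIn_subset _ _ hz (vert_mem_imageOn_iff.mpr h)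
    exact (hW z hzW).2 (connectedComponentIn_eq hz ▸ hb)
  have heq : connectedComponentIn (D.imageOn univ)ᶜ p = connectedComponentIn (D.imageOn W)ᶜ p :=
    (connectedComponentIn_mono p (compl_subset_compl.mpr (imageOn_mono (subset_univ W)))).antisymm
      (isPreconnected_connectedComponentIn.subset_connectedComponentIn
        (mem_connectedComponentIn hp) hdisj)
  obtain ⟨a, -, b, -, c, -, hab, hbc, hac, hfr⟩ :=
    hD p (hdisj (mem_connectedComponentIn hp)) (heq ▸ hb)
  rw [heq] at hfr
  have hsub := hfr ▸ frontier_connectedComponentIn_compl_subset (isClosed_imageOn W) p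
  refine ⟨a, ?_, b, ?_, c, ?_, hab, hbc, hac, hfr⟩ <;> rw [← vert_mem_imageOn_iff (D := D)] <;>
    apply hsub
  · exact .inl (.inl (vert_left_mem_edgeImage hab))
  · exact .inl (.inl (vert_right_mem_edgeImage hab))
  · exact .inr (vert_right_mem_edgeImage hac)

/-- An edge on the outer face of `G` is on the outer face of every induced subgraph. -/
theorem OnOuterEdge.of_univ {W : Set V} {e : Sym2 V} (h : D.OnOuterEdge univ e)
    (he : ∀ x ∈ e, x ∈ W) : D.OnOuterEdge W e :=
  ⟨⟨h.1.1, he⟩, fun _ hp ↦ ⟨closure_mono (outerRegion_anti (subset_univ W)) (h.2 hp).1,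
    fun hi ↦ (interior_subset hi).1 (edgeImage_subset_imageOn ⟨h.1.1, he⟩ hp)⟩⟩

/-! ### Vertices cut off from the outer face by a new vertex -/

/-- The vertices outside of `G[W ∪ {x}]` that do not lie in its outer face. -/
def hiddenBy (D : PlaneDrawing G) (W : Set V) (x : V) : Set V :=
  {z | z ∉ insert x W ∧ D.vert z ∉ D.outerRegion (insert x W)}

theorem isBounded_of_mem_hiddenBy {W : Set V} {x z : V} (hz : z ∈ D.hiddenBy W x) :
    IsBounded (connectedComponentIn (D.imageOn (insert x W))ᶜ (D.vert z)) := by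
  by_contra h
  exact hz.2 ⟨by rw [vert_mem_imageOn_iff]; exact hz.1, h⟩

theorem mem_hiddenBy_of_mem_connectedComponentIn {W : Set V} {x z y : V}
    (hz : z ∈ D.hiddenBy W x)
    (hy : D.vert y ∈ connectedComponentIn (D.imageOn (insert x W))ᶜ (D.vert z)) :
    y ∈ D.hiddenBy W x :=
  ⟨fun h ↦ connectedComponentIn_subset _ _ hy (vert_mem_imageOn_iff.mpr h),
    fun h ↦ h.2 (connectedComponentIn_eq hy ▸ isBounded_of_mem_hiddenBy hz)⟩

/-- The face of `G[W ∪ {x}]` at a point of the outer face does not meet the edges of a vertex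
hidden by `x`. -/
theorem connectedComponentIn_subset_compl_imageOn_insert {W : Set V} {x y : V}
    (hy : y ∈ D.hiddenBy W x) {p : ℝ × ℝ}
    (hp : ¬ IsBounded (connectedComponentIn (D.imageOn (insert x W))ᶜ p)) :
    connectedComponentIn (D.imageOn (insert x W))ᶜ p ⊆ (D.imageOn (insert y W))ᶜ := by
  intro q hq
  rw [imageOn_insert, mem_compl_iff, mem_union, not_or]
  refine ⟨fun h ↦ connectedComponentIn_subset _ _ hq (imageOn_mono (subset_insert x W) h),
    fun h ↦ hp ?_⟩
  rw [connectedComponentIn_eq hq,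
    ← connectedComponentIn_eq (openStar_subset_connectedComponentIn hy.1 h)]
  exact isBounded_of_mem_hiddenBy hy

/-- Two vertices in the outer face of `G[W]` do not hide each other. -/
theorem notMem_hiddenBy_of_mem_hiddenBy [Finite V] {W : Set V} {x y : V}
    (hxW : D.vert x ∈ D.outerRegion W) (hy : y ∈ D.hiddenBy W x) : x ∉ D.hiddenBy W y := by
  intro hx
  obtain ⟨p, hp, hpu⟩ := exists_unbounded_connectedComponentIn_compl
    (isCompact_imageOn (D := D) (insert x W))
  set U := connectedComponentIn (D.imageOn (insert x W))ᶜ p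
  have hUy : U ⊆ (D.imageOn (insert y W))ᶜ :=
    connectedComponentIn_subset_compl_imageOn_insert hy hpu
  have hmono : U ⊆ connectedComponentIn (D.imageOn W)ᶜ p :=
    connectedComponentIn_mono p (compl_subset_compl.mpr (imageOn_mono (subset_insert x W)))
  have hO : connectedComponentIn (D.imageOn W)ᶜ p =
      connectedComponentIn (D.imageOn W)ᶜ (D.vert x) :=
    connectedComponentIn_compl_eq_of_unbounded (isCompact_imageOn W)
      (fun h ↦ hpu (h.subset hmono)) hxW.2
  obtain ⟨q, hqO, hqU⟩ := IsPreconnected.inter_frontier_nonempty_of_mem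
    (isPreconnected_connectedComponentIn (F := (D.imageOn W)ᶜ) (x := D.vert x))
    ((isClosed_imageOn (D := D) (insert x W)).isOpen_compl.connectedComponentIn (x := p))
    (hO ▸ hmono (mem_connectedComponentIn hp)) (mem_connectedComponentIn hp)
    (mem_connectedComponentIn hxW.1)
    (fun h ↦ connectedComponentIn_subset _ _ h (vert_mem_imageOn_iff.mpr (mem_insert x W)))
  have hq := frontier_connectedComponentIn_compl_subset (isClosed_imageOn (insert x W)) p hqU
  rw [imageOn_insert] at hq
  have hqK := openStar_subset_connectedComponentIn hx.1
    (hq.resolve_left (connectedComponentIn_subset _ _ hqO))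
  obtain ⟨r, hrK, hrU⟩ := mem_closure_iff.mp hqU.1 _
    (isClosed_imageOn (D := D) (insert y W)).isOpen_compl.connectedComponentIn hqK
  refine hpu ((isBounded_of_mem_hiddenBy hx).subset ?_)
  rw [connectedComponentIn_eq hrK]
  exact isPreconnected_connectedComponentIn.subset_connectedComponentIn hrU hUy

theorem hiddenBy_subset_of_mem_hiddenBy [Finite V] {W : Set V} {x y : V}
    (hxW : D.vert x ∈ D.outerRegion W) (hy : y ∈ D.hiddenBy W x) :
    D.hiddenBy W y ⊆ D.hiddenBy W x := by
  intro z hz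
  have hzx : z ≠ x := fun h ↦ notMem_hiddenBy_of_mem_hiddenBy hxW hy (h ▸ hz)
  have hzW : z ∉ insert x W := fun h ↦ hz.1 (.inr (h.resolve_left hzx))
  refine ⟨hzW, fun h ↦ h.2 ((isBounded_of_mem_hiddenBy hz).subset ?_)⟩
  exact isPreconnected_connectedComponentIn.subset_connectedComponentIn
    (mem_connectedComponentIn h.1) (connectedComponentIn_subset_compl_imageOn_insert hy h.2)

end PlaneDrawing

theorem HasContinuousLogs.union_finite {X : Type*} [TopologicalSpace X] [T1Space X] {K s : Set X}
    (hK : HasContinuousLogs K) (cK : IsClosed K) (hs : s.Finite) :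
    HasContinuousLogs (K ∪ s) := by
  induction s, hs using Set.Finite.induction_on with
  | empty => simpa
  | @insert p t _ ht ih =>
    rw [← singleton_union, union_comm {p}, ← union_assoc]
    exact ih.union (hasContinuousLogs_singleton p) (cK.union ht.isClosed) isClosed_singleton
      (subsingleton_singleton.anti inter_subset_right)

namespace PlaneDrawing

variable {V : Type} {G : SimpleGraph V} {D : PlaneDrawing G}

theorem edgeImage_inter_edgeImage_subset {x y z : V} (hy : G.Adj x y) (hz : G.Adj x z)
    (hyz : y ≠ z) : D.edgeImage s(x, y) ∩ D.edgeImage s(x, z) ⊆ {D.vert x} := by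
  rintro p ⟨hp, hq⟩
  rw [edgeImage_eq hy] at hp
  rw [edgeImage_eq hz] at hq
  have hne : s(x, y) ≠ s(x, z) := by simp [hyz, hy.ne']
  rcases hp with hp | rfl | rfl
  · rcases hq with hq | rfl | rfl
    · exact ((D.edge_disjoint _ hy _ hz hne).subset ⟨hp, hq⟩).elim
    · rfl
    · exact absurd hp (D.edge_int_vert _ hy z)
  · rfl
  · rcases hq with hq | hq | hq
    · exact absurd hq (D.edge_int_vert _ hz y)
    · exact hq
    · exact absurd (D.vert_inj hq) hyz

/-- A vertex together with its edges towards `N`. -/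
def closedStar (D : PlaneDrawing G) (N : Set V) (x : V) : Set (ℝ × ℝ) :=
  insert (D.vert x) (⋃ y ∈ N, D.edgeImage s(x, y))

theorem isClosed_closedStar {N : Set V} {x : V} (hN : N.Finite) (h : ∀ y ∈ N, G.Adj x y) :
    IsClosed (D.closedStar N x) :=
  isClosed_singleton.union
    (hN.isClosed_biUnion fun y hy ↦ (isCompact_edgeImage (e := s(x, y)) (h y hy)).isClosed)

theorem hasContinuousLogs_closedStar {N : Set V} {x : V} (hN : N.Finite)
    (h : ∀ y ∈ N, G.Adj x y) : HasContinuousLogs (D.closedStar N x) := by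
  induction N, hN using Set.Finite.induction_on with
  | empty => simpa [closedStar] using hasContinuousLogs_singleton (D.vert x)
  | @insert y N hyN hN ih =>
    have hxy : G.Adj x y := h y (mem_insert y N)
    have hxN : ∀ z ∈ N, G.Adj x z := fun z hz ↦ h z (mem_insert_of_mem y hz)
    have heq : D.closedStar (insert y N) x = D.closedStar N x ∪ D.edgeImage s(x, y) := by
      rw [closedStar, closedStar, biUnion_insert, insert_union, union_comm]
    rw [heq]
    refine (ih hxN).union (hasContinuousLogs_arc (D.edge_cont _ hxy) (D.edge_injOn _ hxy))
      (isClosed_closedStar hN hxN) (isCompact_edgeImage (e := s(x, y)) hxy).isClosed ?_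
    refine (subsingleton_singleton (a := D.vert x)).anti ?_
    rintro p ⟨rfl | hp, hpy⟩
    · rfl
    · obtain ⟨z, hz, hp⟩ := mem_iUnion₂.mp hp
      exact edgeImage_inter_edgeImage_subset (hxN z hz) hxy (fun h ↦ hyN (h ▸ hz)) ⟨hp, hpy⟩

theorem edgeInterior_nonempty (e : Sym2 V) : (D.edgeInterior e).Nonempty :=
  (nonempty_Ioo.mpr zero_lt_one).image _

/-- Adjacent vertices outside of `U` lie in the same face of the drawing of `U`. -/
theorem vert_mem_connectedComponentIn_of_adj {U : Set V} {a b : V} {p : ℝ × ℝ} (hab : G.Adj a b)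
    (ha : D.vert a ∈ connectedComponentIn (D.imageOn U)ᶜ p) (hb : b ∉ U) :
    D.vert b ∈ connectedComponentIn (D.imageOn U)ᶜ p := by
  have haU : a ∉ U := fun h ↦ connectedComponentIn_subset _ _ ha (vert_mem_imageOn_iff.mpr h)
  obtain ⟨q, hq⟩ := D.edgeInterior_nonempty s(a, b)
  have h1 := connectedComponentIn_eq (edgeInterior_subset_connectedComponentIn hab haU hq)
  have h2 := connectedComponentIn_eq
    (edgeInterior_subset_connectedComponentIn hab.symm hb (Sym2.eq_swap ▸ hq))
  rw [connectedComponentIn_eq ha, h1, ← h2]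
  exact mem_connectedComponentIn (by rwa [mem_compl_iff, vert_mem_imageOn_iff])

theorem closedStar_subset_of_vert_mem_connectedComponentIn {U : Set V} {z : V} {p : ℝ × ℝ}
    (hz : D.vert z ∈ connectedComponentIn (D.imageOn U)ᶜ p) :
    D.closedStar (G.neighborSet z) z ⊆ connectedComponentIn (D.imageOn U)ᶜ p ∪ D.vert '' U := by
  have hzU : z ∉ U := fun h ↦ connectedComponentIn_subset _ _ hz (vert_mem_imageOn_iff.mpr h)
  rintro q (rfl | hq)
  · exact .inl hz
  · obtain ⟨b, hb, hq⟩ := mem_iUnion₂.mp hq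
    rw [edgeImage_eq hb] at hq
    rcases hq with hq | rfl | rfl
    · rw [connectedComponentIn_eq hz]
      exact .inl (edgeInterior_subset_connectedComponentIn hb hzU hq)
    · exact .inl hz
    · by_cases hbU : b ∈ U
      · exact .inr ⟨b, hbU, rfl⟩
      · exact .inl (vert_mem_connectedComponentIn_of_adj hb hz hbU)

/-- A face of `G[W ∪ {x}]` containing a vertex, all of whose vertices have at most one neighbour
in `W`, is bounded by edges at `x` and vertices of `W` only. -/
theorem frontier_connectedComponentIn_subset_closedStar [Finite V] {W : Set V} {x z₀ : V}
    (hD : D.InnerFacesTriangulated univ) (hz₀ : z₀ ∈ D.hiddenBy W x)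
    (hnbr : ∀ z ∈ D.hiddenBy W x, (nbrsIn G W z).Subsingleton) :
    frontier (connectedComponentIn (D.imageOn (insert x W))ᶜ (D.vert z₀)) ⊆
      D.closedStar (nbrsIn G W x) x ∪ D.vert '' W := by
  set U := insert x W with hU
  set C := connectedComponentIn (D.imageOn U)ᶜ (D.vert z₀) with hC
  set K := D.closedStar (nbrsIn G W x) x ∪ D.vert '' W
  set S := K ∪ ⋃ z ∈ {z | D.vert z ∈ C}, D.closedStar (G.neighborSet z) z
  have hCopen : IsOpen C := (isClosed_imageOn U).isOpen_compl.connectedComponentIn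
  have hz₀C : D.vert z₀ ∈ C :=
    mem_connectedComponentIn (by rw [mem_compl_iff, vert_mem_imageOn_iff]; exact hz₀.1)
  have hSclosed : IsClosed S :=
    ((isClosed_closedStar (toFinite _) fun y hy ↦ hy.2).union (toFinite _).isClosed).union
      ((toFinite _).isClosed_biUnion fun z _ ↦ isClosed_closedStar (toFinite _) fun y hy ↦ hy)
  have hSsub : S ⊆ C ∪ K := by
    refine union_subset subset_union_right (iUnion₂_subset fun z hz ↦ ?_)
    refine (closedStar_subset_of_vert_mem_connectedComponentIn hz).trans
      (union_subset_union_right C ?_)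
    rw [hU, image_insert_eq]
    exact insert_subset (.inl (.inl rfl)) subset_union_right
  -- the boundary of a triangle all of whose new vertices lie in `C` is part of `S`
  have hedge : ∀ a b c : V, G.Adj a b → G.Adj b c → G.Adj a c → (a ∉ U → D.vert a ∈ C) →
      (b ∉ U → D.vert b ∈ C) → (c ∉ U → D.vert c ∈ C) → ¬ (a ∈ U ∧ b ∈ U ∧ c ∈ U) →
      D.edgeImage s(a, b) ⊆ S := by
    intro a b c hab hbc hac ha hb hc hnot
    have hstar : ∀ {a b : V}, G.Adj a b → D.vert a ∈ C → D.edgeImage s(a, b) ⊆ S :=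
      fun {a b} hab ha p hp ↦ .inr (mem_biUnion (show a ∈ {z | D.vert z ∈ C} from ha)
        (.inr (mem_biUnion (show b ∈ G.neighborSet a from hab) hp)))
    have hx : ∀ {y : V}, G.Adj x y → y ∈ U → D.edgeImage s(x, y) ⊆ S :=
      fun {y} hxy hy p hp ↦ .inl (.inl (.inr (mem_biUnion
        (show y ∈ nbrsIn G W x from ⟨hy.resolve_left hxy.ne', hxy⟩) hp)))
    by_cases haU : a ∈ U
    · by_cases hbU : b ∈ U
      · have hcU : c ∉ U := fun h ↦ hnot ⟨haU, hbU, h⟩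
        have hsub := hnbr c (mem_hiddenBy_of_mem_connectedComponentIn hz₀ (hc hcU))
        rcases haU with rfl | haW
        · exact hx hab hbU
        rcases hbU with rfl | hbW
        · rw [Sym2.eq_swap]
          exact hx hab.symm (.inr haW)
        · exact absurd (hsub ⟨haW, hac.symm⟩ ⟨hbW, hbc.symm⟩) hab.ne
      · rw [Sym2.eq_swap]
        exact hstar hab.symm (hb hbU)
    · exact hstar hab (ha haU)
  have hnotC : ∀ q ∈ frontier C, q ∉ C := fun q hq h ↦ hq.2 (hCopen.interior_eq.symm ▸ h)
  have hfrontier : frontier C ⊆ S := by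
    rw [← hSclosed.closure_eq]
    intro q hq
    rw [Metric.mem_closure_iff]
    intro ε hε
    obtain ⟨p, hpC, hpq⟩ := Metric.mem_closure_iff.mp hq.1 ε hε
    by_cases hpu : p ∈ D.imageOn univ
    · obtain ⟨z, hz, hpz⟩ := exists_vert_mem_of_mem_imageOn_univ hpC hpu
      refine ⟨p, .inr (mem_biUnion (show z ∈ {z | D.vert z ∈ C} from hz) ?_), hpq⟩
      rcases hpz with rfl | ⟨b, hb, hpb⟩
      · exact .inl rfl
      · exact .inr (mem_biUnion (show b ∈ G.neighborSet z from hb)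
          (edgeInterior_subset_edgeImage _ hpb))
    set f := connectedComponentIn (D.imageOn univ)ᶜ p with hf
    have hfC : f ⊆ C := by
      rw [hC, connectedComponentIn_eq hpC]
      exact connectedComponentIn_mono p (compl_subset_compl.mpr (imageOn_mono (subset_univ U)))
    obtain ⟨a, -, b, -, c, -, hab, hbc, hac, hfr⟩ :=
      hD p hpu ((isBounded_of_mem_hiddenBy hz₀).subset hfC)
    rw [← hf] at hfr
    have hfopen : IsOpen f := (isClosed_imageOn univ).isOpen_compl.connectedComponentIn
    have hvert : ∀ d, D.vert d ∈ frontier f → d ∉ U → D.vert d ∈ C := fun d hd hdU ↦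
      (closure_connectedComponentIn_compl_subset (isClosed_imageOn U) _
        (closure_mono hfC hd.1)).resolve_right (by rwa [vert_mem_imageOn_iff])
    have ha := hvert a (hfr ▸ .inl (.inl (vert_left_mem_edgeImage hab)))
    have hb := hvert b (hfr ▸ .inl (.inl (vert_right_mem_edgeImage hab)))
    have hc := hvert c (hfr ▸ .inr (vert_right_mem_edgeImage hac))
    have hnot : ¬ (a ∈ U ∧ b ∈ U ∧ c ∈ U) := by
      rintro ⟨haU, hbU, hcU⟩
      obtain ⟨r, hrC, hr⟩ := (isPreconnected_connectedComponentIn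
        (F := (D.imageOn U)ᶜ)).inter_frontier_nonempty_of_mem hfopen hpC
        (mem_connectedComponentIn hpu) hz₀C
        (fun h ↦ connectedComponentIn_subset _ _ h (vert_mem_imageOn_iff.mpr (mem_univ z₀)))
      rw [hfr] at hr
      refine connectedComponentIn_subset _ _ hrC ?_
      rcases hr with (hr | hr) | hr
      · exact edgeImage_subset_imageOn (mem_edgesWithin_mk.mpr ⟨hab, haU, hbU⟩) hr
      · exact edgeImage_subset_imageOn (mem_edgesWithin_mk.mpr ⟨hbc, hbU, hcU⟩) hr
      · exact edgeImage_subset_imageOn (mem_edgesWithin_mk.mpr ⟨hac, haU, hcU⟩) hr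
    obtain ⟨s, hsball, hs⟩ := (convex_ball q ε).isPreconnected.inter_frontier_nonempty_of_mem hfopen
      (show p ∈ Metric.ball q ε by rwa [Metric.mem_ball, dist_comm]) (mem_connectedComponentIn hpu)
      (Metric.mem_ball_self hε) (fun h ↦ hnotC q hq (hfC h))
    refine ⟨s, ?_, by rwa [Metric.mem_ball, dist_comm] at hsball⟩
    rw [hfr] at hs
    rcases hs with (hs | hs) | hs
    · exact hedge a b c hab hbc hac ha hb hc hnot hs
    · exact hedge b c a hbc hac.symm hab.symm hb hc ha (fun h ↦ hnot ⟨h.2.2, h.1, h.2.1⟩) hs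
    · exact hedge a c b hac hbc.symm hab ha hc hb (fun h ↦ hnot ⟨h.1, h.2.2, h.2.1⟩) hs
  intro q hq
  exact (hSsub (hfrontier hq)).resolve_left (hnotC q hq)

theorem exists_mem_hiddenBy_not_subsingleton [Finite V] {W : Set V} {x : V}
    (hD : D.InnerFacesTriangulated univ) (h : (D.hiddenBy W x).Nonempty) :
    ∃ y ∈ D.hiddenBy W x, ¬ (nbrsIn G W y).Subsingleton := by
  obtain ⟨z, hz⟩ := h
  by_contra! hnbr
  have hcl := isClosed_closedStar (D := D) (toFinite (nbrsIn G W x)) fun y hy ↦ hy.2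
  have hfin : (D.vert '' W).Finite := toFinite _
  have hmem : D.vert z ∉ D.imageOn (insert x W) := by
    rw [vert_mem_imageOn_iff]
    exact hz.1
  refine ((hasContinuousLogs_closedStar (toFinite _) fun y hy ↦ hy.2).union_finite hcl
    hfin).not_isBounded (hcl.union hfin.isClosed)
    (frontier_connectedComponentIn_subset_closedStar hD hz hnbr)
    (mem_connectedComponentIn hmem) (fun hzK ↦ hmem ?_) (isBounded_of_mem_hiddenBy hz)
  rcases hzK with (hzx | hzK) | ⟨w, hw, hwz⟩
  · exact .inl ⟨x, mem_insert x W, hzx.symm⟩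
  · obtain ⟨y, hy, hzy⟩ := mem_iUnion₂.mp hzK
    exact edgeImage_subset_imageOn
      (mem_edgesWithin_mk.mpr ⟨hy.2, mem_insert x W, mem_insert_of_mem x hy.1⟩) hzy
  · exact .inl ⟨w, mem_insert_of_mem x hw, hwz⟩

theorem exists_mem_hiddenBy_eq_empty [Finite V] {W : Set V} {x : V}
    (hD : D.InnerFacesTriangulated univ) (hW : ∀ z ∉ W, D.vert z ∈ D.outerRegion W)
    (hx : x ∉ W) (h : (D.hiddenBy W x).Nonempty) :
    ∃ y ∈ D.hiddenBy W x, ¬ (nbrsIn G W y).Subsingleton ∧ D.hiddenBy W y = ∅ := by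
  induction hn : (D.hiddenBy W x).ncard using Nat.strong_induction_on generalizing x with
  | _ n ih =>
    obtain ⟨y, hy, hynbr⟩ := exists_mem_hiddenBy_not_subsingleton hD h
    rcases (D.hiddenBy W y).eq_empty_or_nonempty with hemp | hne
    · exact ⟨y, hy, hynbr, hemp⟩
    · have hsub := hiddenBy_subset_of_mem_hiddenBy (hW x hx) hy
      have hyy : y ∉ D.hiddenBy W y := fun h ↦ h.1 (mem_insert y W)
      have hlt : (D.hiddenBy W y).ncard < n :=
        hn ▸ ncard_lt_ncard ⟨hsub, fun h ↦ hyy (h hy)⟩ (toFinite _)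
      obtain ⟨u, hu, hu'⟩ := ih _ hlt (fun h ↦ hy.1 (.inr h)) hne rfl
      exact ⟨u, hsub hu, hu'⟩

theorem vert_mem_Rregion_iff {W : Set V} {x z : V} (hW : ∀ z ∉ W, D.vert z ∈ D.outerRegion W)
    (hx : ¬ (nbrsIn G W x).Subsingleton) :
    D.vert z ∈ Rregion D W x ↔ z ∈ D.hiddenBy W x := by
  have heq : D.imageOn W ∪ ⋃ y ∈ nbrsIn G W x, D.edgeImage s(x, y) = D.imageOn (insert x W) := by
    obtain ⟨y, hy, -⟩ := not_subsingleton_iff.mp hx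
    apply Subset.antisymm
    · refine union_subset (imageOn_mono (subset_insert x W)) (iUnion₂_subset fun y hy ↦ ?_)
      exact edgeImage_subset_imageOn
        (mem_edgesWithin_mk.mpr ⟨hy.2, mem_insert x W, mem_insert_of_mem x hy.1⟩)
    · rw [imageOn_insert]
      refine union_subset_union_right _ (insert_subset
        (mem_biUnion hy (vert_left_mem_edgeImage hy.2)) ?_)
      exact iUnion₂_mono fun y _ ↦ edgeInterior_subset_edgeImage _
  rw [Rregion, if_neg hx, heq]
  constructor
  · rintro ⟨h1, h2, h3⟩
    refine ⟨?_, fun h ↦ h.2 h3⟩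
    rw [← vert_mem_imageOn_iff (D := D), ← heq]
    exact fun h ↦ h.elim h1.1 h2
  · intro hz
    have hmem : D.vert z ∉ D.imageOn (insert x W) := by
      rw [vert_mem_imageOn_iff]
      exact hz.1
    rw [← heq] at hmem
    exact ⟨hW z fun h ↦ hz.1 (.inr h), fun h ↦ hmem (.inr h), isBounded_of_mem_hiddenBy hz⟩

end PlaneDrawing

/-! ### Biconnected induced subgraphs -/

section Biconnected

variable {V : Type} {G : SimpleGraph V} {W : Set V} {x : V}

theorem connected_induce_induce_ne_iff (x : W) :
    ((G.induce W).induce {y | y ≠ x}).Connected ↔ (G.induce (W \ {(x : V)})).Connected := by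
  refine SimpleGraph.Iso.connected_iff ⟨⟨fun y ↦ ⟨y.1, y.1.2, fun h ↦ y.2 (Subtype.ext h)⟩,
    fun y ↦ ⟨⟨y.1, y.2.1⟩, fun h ↦ y.2.2 (congrArg Subtype.val h)⟩, fun _ ↦ rfl, fun _ ↦ rfl⟩,
    Iff.rfl⟩

theorem connected_induce_insert {y : V} (hW : (G.induce W).Connected) (hy : y ∈ W)
    (hxy : G.Adj x y) : (G.induce (insert x W)).Connected := by
  rw [← singleton_union]
  exact SimpleGraph.connected_induce_union SimpleGraph.Preconnected.of_subsingleton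
    hW.preconnected (mem_singleton x) hy hxy

theorem Biconnected.induce_insert (hW : Biconnected (G.induce W)) (hx : x ∉ W)
    (hnbr : ¬ (nbrsIn G W x).Subsingleton) : Biconnected (G.induce (insert x W)) := by
  obtain ⟨a, ha, b, hb, hab⟩ := not_subsingleton_iff.mp hnbr
  refine ⟨connected_induce_insert hW.1 ha.1 ha.2, fun y ↦ ?_⟩
  rw [connected_induce_induce_ne_iff]
  rcases y.2 with hy | hy
  · rw [hy, insert_sdiff_self_of_notMem hx]
    exact hW.1
  · have hxy : x ≠ y := fun h ↦ hx (h ▸ hy)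
    rw [insert_sdiff_of_notMem _ (by simpa using hxy)]
    have hcon := (connected_induce_induce_ne_iff (W := W) ⟨y, hy⟩).mp (hW.2 ⟨y, hy⟩)
    by_cases hay : a = y
    · exact connected_induce_insert hcon ⟨hb.1, fun h ↦ hab (hay.trans h.symm)⟩ hb.2
    · exact connected_induce_insert hcon ⟨ha.1, hay⟩ ha.2

theorem exists_adj_of_connected_induce_insert (hW : (G.induce (insert x W)).Connected)
    (hx : x ∉ W) (hne : W.Nonempty) : ∃ y ∈ W, G.Adj x y := by
  obtain ⟨z, hz⟩ := hne
  have : Nontrivial ↥(insert x W) := nontrivial_coe_sort.mpr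
    ⟨x, mem_insert x W, z, mem_insert_of_mem x hz, fun h ↦ hx (h ▸ hz)⟩
  obtain ⟨y, hy⟩ := hW.preconnected.exists_adj_of_nontrivial ⟨x, mem_insert x W⟩
  have hxy : G.Adj x y := hy
  exact ⟨y, y.2.resolve_left hxy.ne', hxy⟩

theorem Biconnected.not_subsingleton_nbrsIn (hW : Biconnected (G.induce (insert x W)))
    (hx : x ∉ W) (hnt : W.Nontrivial) : ¬ (nbrsIn G W x).Subsingleton := by
  intro hsub
  obtain ⟨y, hy, hxy⟩ := exists_adj_of_connected_induce_insert hW.1 hx hnt.nonempty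
  have hcon := (connected_induce_induce_ne_iff _).mp (hW.2 ⟨y, mem_insert_of_mem x hy⟩)
  rw [insert_sdiff_of_notMem _ (by simpa using hxy.ne)] at hcon
  obtain ⟨u, hu, huy⟩ := hnt.exists_ne y
  obtain ⟨z, hz, hxz⟩ := exists_adj_of_connected_induce_insert hcon (fun h ↦ hx h.1) ⟨u, hu, huy⟩
  exact hz.2 (hsub ⟨hz.1, hxz⟩ ⟨hy, hxy⟩)

end Biconnected

/-! ### Extending canonical orderings -/

section Ordering

variable {V : Type} {v w : ℕ → V} {i m : ℕ}

theorem Vset_succ (v : ℕ → V) (i : ℕ) : Vset v (i + 1) = insert (v (i + 1)) (Vset v i) := by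
  rw [Vset, Vset, ← image_insert_eq]
  congr 1
  ext k
  simp only [mem_Icc, mem_insert_iff]
  omega

theorem Vset_mono (v : ℕ → V) (h : i ≤ m) : Vset v i ⊆ Vset v m :=
  image_mono (Icc_subset_Icc_right h)

theorem mem_Vset (h1 : 1 ≤ m) (hm : m ≤ i) : v m ∈ Vset v i := ⟨m, ⟨h1, hm⟩, rfl⟩

theorem Vset_congr (h : ∀ m, 1 ≤ m → m ≤ i → w m = v m) (hm : m ≤ i) : Vset w m = Vset v m :=
  image_congr fun k hk ↦ h k hk.1 (hk.2.trans hm)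

theorem extendSeq_of_le (v : ℕ → V) (x : V) (h : m ≤ i) : extendSeq v i x m = v m :=
  if_neg (by omega)

theorem extendSeq_succ (v : ℕ → V) (i : ℕ) (x : V) : extendSeq v i x (i + 1) = x := if_pos rfl

theorem Vset_extendSeq_of_le (v : ℕ → V) (x : V) (h : m ≤ i) :
    Vset (extendSeq v i x) m = Vset v m :=
  Vset_congr (fun _ _ hk ↦ extendSeq_of_le v x hk) h

theorem Vset_extendSeq_succ (v : ℕ → V) (i : ℕ) (x : V) :
    Vset (extendSeq v i x) (i + 1) = insert x (Vset v i) := by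
  rw [Vset_succ, extendSeq_succ, Vset_extendSeq_of_le v x le_rfl]

theorem ncard_Vset (hinj : InjOn v (Icc 1 m)) : (Vset v m).ncard = m := by
  rw [Vset, hinj.ncard_image, ← Finset.coe_Icc, ncard_coe_finset, Nat.card_Icc,
    Nat.add_sub_cancel]

variable {G : SimpleGraph V} {D : PlaneDrawing G} {W : Set V}

theorem nontrivial_Vset (hadj : G.Adj (w 1) (w 2)) (h2 : 2 ≤ m) : (Vset w m).Nontrivial :=
  ⟨w 1, mem_Vset le_rfl (by omega), w 2, mem_Vset (by omega) h2, hadj.ne⟩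

/-- The vertex set `W` may serve as an initial segment of a canonical ordering: `G[W]` is
biconnected and all other vertices lie in its outer face. -/
def IsOuterBiconnected (D : PlaneDrawing G) (W : Set V) : Prop :=
  Biconnected (G.induce W) ∧ ∀ z ∉ W, D.vert z ∈ D.outerRegion W

theorem IsOuterBiconnected.insert {x : V} (hW : IsOuterBiconnected D W) (hx : x ∉ W)
    (hnbr : ¬ (nbrsIn G W x).Subsingleton) (hhid : D.hiddenBy W x = ∅) :
    IsOuterBiconnected D (insert x W) := by
  refine ⟨hW.1.induce_insert hx hnbr, fun z hz ↦ ?_⟩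
  by_contra h
  exact (hhid.subset ⟨hz, h⟩ : z ∈ (∅ : Set V))

theorem IsOuterBiconnected.internallyTriangulatedOn [Finite V] (hW : IsOuterBiconnected D W)
    (hD : D.InnerFacesTriangulated univ) : InternallyTriangulatedOn D W :=
  ⟨hW.1, hD.of_forall_mem_outerRegion hW.2⟩

variable [Fintype V]

theorem Vset_card_eq_univ (hw : BijOn w (Icc 1 (Fintype.card V)) univ) :
    Vset w (Fintype.card V) = univ := hw.image_eq

theorem isOuterBiconnected_Vset (hw : BijOn w (Icc 1 (Fintype.card V)) univ)
    (hco : IsCanonicalOrdering D (Fintype.card V) w) (h3 : 3 ≤ m) (hm : m ≤ Fintype.card V) :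
    IsOuterBiconnected D (Vset w m) := by
  obtain ⟨htri, -, hout⟩ := hco.2.2.2 m h3 hm
  refine ⟨htri.1, fun z hz ↦ ?_⟩
  obtain ⟨j, hj, rfl⟩ := hw.surjOn (mem_univ z)
  exact hout j (not_le.mp fun h ↦ hz (mem_Vset hj.1 h)) hj.2

/-- The first vertex of a canonical ordering outside of `W` has two neighbours in `W`. -/
theorem exists_not_subsingleton_nbrsIn (hw : BijOn w (Icc 1 (Fintype.card V)) univ)
    (hco : IsCanonicalOrdering D (Fintype.card V) w) (h1 : w 1 ∈ W) (h2 : w 2 ∈ W)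
    (hne : W ≠ univ) : ∃ x ∉ W, ¬ (nbrsIn G W x).Subsingleton := by
  classical
  obtain ⟨z, hz⟩ := (ne_univ_iff_exists_notMem W).mp hne
  have hex : ∃ j, 1 ≤ j ∧ w j ∉ W := by
    obtain ⟨j, hj, rfl⟩ := hw.surjOn (mem_univ z)
    exact ⟨j, hj.1, hz⟩
  obtain ⟨hj1, hjW⟩ := Nat.find_spec hex
  have hmin : ∀ k, 1 ≤ k → k < Nat.find hex → w k ∈ W := fun k hk hlt ↦ by
    by_contra h
    exact Nat.find_min hex hlt ⟨hk, h⟩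
  have hjcard : Nat.find hex ≤ Fintype.card V := by
    obtain ⟨j, hj, rfl⟩ := hw.surjOn (mem_univ z)
    exact (Nat.find_min' hex ⟨hj.1, hz⟩).trans hj.2
  generalize Nat.find hex = j at *
  obtain ⟨k, rfl⟩ : ∃ k, j = k + 1 := ⟨j - 1, by omega⟩
  have hk0 : k ≠ 0 := fun h ↦ hjW (by simpa [h] using h1)
  have hk1 : k ≠ 1 := fun h ↦ hjW (by simpa [h] using h2)
  have hsub : Vset w k ⊆ W := by
    rintro _ ⟨l, hl, rfl⟩
    exact hmin l hl.1 (Nat.lt_succ_of_le hl.2)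
  have hbi := (hco.2.2.2 (k + 1) (by omega) hjcard).1.1
  rw [Vset_succ] at hbi
  exact ⟨w (k + 1), hjW, fun h ↦ hbi.not_subsingleton_nbrsIn (fun h ↦ hjW (hsub h))
    (nontrivial_Vset hco.2.2.1 (by omega)) (h.anti (nbrsIn_mono hsub _))⟩

theorem IsOuterBiconnected.exists_insert (hW : IsOuterBiconnected D W)
    (hD : D.InnerFacesTriangulated univ) (hw : BijOn w (Icc 1 (Fintype.card V)) univ)
    (hco : IsCanonicalOrdering D (Fintype.card V) w) (h1 : w 1 ∈ W) (h2 : w 2 ∈ W)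
    (hne : W ≠ univ) : ∃ y ∉ W, IsOuterBiconnected D (Insert.insert y W) := by
  obtain ⟨x, hx, hnbr⟩ := exists_not_subsingleton_nbrsIn hw hco h1 h2 hne
  rcases (D.hiddenBy W x).eq_empty_or_nonempty with hemp | hhid
  · exact ⟨x, hx, hW.insert hx hnbr hemp⟩
  · obtain ⟨y, hy, hnbr, hemp⟩ := D.exists_mem_hiddenBy_eq_empty hD hW.2 hx hhid
    exact ⟨y, fun h ↦ hy.1 (.inr h), hW.insert (fun h ↦ hy.1 (.inr h)) hnbr hemp⟩

theorem IsCanonicalOrdering.extendSeq {y : V} (hu : IsCanonicalOrdering D m v)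
    (hD : D.InnerFacesTriangulated univ) (hout : D.OnOuterEdge univ s(v 1, v 2))
    (hW : IsOuterBiconnected D (Vset v m)) (hy : y ∉ Vset v m)
    (hyW : IsOuterBiconnected D (insert y (Vset v m))) :
    IsCanonicalOrdering D (m + 1) (extendSeq v m y) := by
  obtain ⟨h3, hinj, hadj, hlev⟩ := hu
  have e1 : _root_.extendSeq v m y 1 = v 1 := extendSeq_of_le v y (by omega)
  have e2 : _root_.extendSeq v m y 2 = v 2 := extendSeq_of_le v y (by omega)
  refine ⟨by omega, ?_, by rwa [e1, e2], fun l hl hlm ↦ ?_⟩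
  · intro a ha b hb hab
    have key : ∀ k ∈ Icc 1 (m + 1), k = m + 1 ∨ k ∈ Icc 1 m := fun k hk ↦ by
      simp only [mem_Icc] at hk ⊢
      omega
    rcases key a ha with rfl | ha <;> rcases key b hb with rfl | hb
    · rfl
    · rw [extendSeq_succ, extendSeq_of_le v y hb.2] at hab
      exact absurd (hab ▸ mem_Vset hb.1 hb.2) hy
    · rw [extendSeq_succ, extendSeq_of_le v y ha.2] at hab
      exact absurd (hab ▸ mem_Vset ha.1 ha.2) hy
    · rw [extendSeq_of_le v y hb.2, extendSeq_of_le v y ha.2] at hab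
      exact hinj ha hb hab
  · rw [e1, e2]
    rcases Nat.le_succ_iff.mp hlm with hlm | rfl
    · rw [Vset_extendSeq_of_le v y hlm]
      obtain ⟨c1, c2, c3⟩ := hlev l hl hlm
      refine ⟨c1, c2, fun j hlj hjm ↦ ?_⟩
      rcases Nat.le_succ_iff.mp hjm with hjm | rfl
      · rw [extendSeq_of_le v y hjm]
        exact c3 j hlj hjm
      · rw [extendSeq_succ]
        exact D.outerRegion_anti (Vset_mono v hlm) (hW.2 y hy)
    · rw [Vset_extendSeq_succ]
      refine ⟨hyW.internallyTriangulatedOn hD, hout.of_univ ?_, fun j h1 h2 ↦ by omega⟩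
      have m1 : v 1 ∈ Vset v m := mem_Vset le_rfl (by omega)
      have m2 : v 2 ∈ Vset v m := mem_Vset (by omega) (by omega)
      simp [m1, m2]

theorem IsCanonicalOrdering.extensibleOrd (hu : IsCanonicalOrdering D m v)
    (hD : D.InnerFacesTriangulated univ) (hW : IsOuterBiconnected D (Vset v m))
    (hw : BijOn w (Icc 1 (Fintype.card V)) univ)
    (hco : IsCanonicalOrdering D (Fintype.card V) w) (h1 : w 1 = v 1) (h2 : w 2 = v 2) :
    ExtensibleOrd D m v := by
  induction hn : Fintype.card V - m generalizing m v with
  | zero =>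
    have hcard : m = Fintype.card V := by
      have := ncard_le_card (Vset v m)
      rw [ncard_Vset hu.2.1, Nat.card_eq_fintype_card] at this
      omega
    subst hcard
    refine ⟨v, fun _ _ _ ↦ rfl, ⟨mapsTo_univ _ _, hu.2.1, ?_⟩, hu⟩
    have : Vset v (Fintype.card V) = univ :=
      eq_of_subset_of_ncard_le (subset_univ _)
        (by rw [ncard_Vset hu.2.1, ncard_univ, Nat.card_eq_fintype_card])
    exact this.ge
  | succ n ih =>
    have h3 := hu.1
    have hne : Vset v m ≠ univ := fun h ↦ by
      have := ncard_Vset hu.2.1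
      rw [h, ncard_univ, Nat.card_eq_fintype_card] at this
      omega
    have hout : D.OnOuterEdge univ s(v 1, v 2) := by
      have := (hco.2.2.2 _ hco.1 le_rfl).2.1
      rwa [Vset_card_eq_univ hw, h1, h2] at this
    obtain ⟨y, hy, hyW⟩ := hW.exists_insert hD hw hco (h1 ▸ mem_Vset le_rfl (by omega))
      (h2 ▸ mem_Vset (by omega) (by omega)) hne
    obtain ⟨u, huv, hrest⟩ := ih (hu.extendSeq hD hout hW hy hyW)
      (by rwa [Vset_extendSeq_succ]) (by rwa [extendSeq_of_le v y (by omega)])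
      (by rwa [extendSeq_of_le v y (by omega)]) (by omega)
    exact ⟨u, fun k hk hkm ↦ (huv k hk (by omega)).trans (extendSeq_of_le v y hkm), hrest⟩

/-- A vertex is eligible iff it can be added to the initial segment. -/
theorem eligible_iff_isOuterBiconnected {x : V} (hD : D.InnerFacesTriangulated univ)
    (hco : IsCanonicalOrdering D i v) (hext : ExtensibleOrd D i v)
    (hW : IsOuterBiconnected D (Vset v i)) (hx : x ∉ Vset v i) :
    Eligible D i v x ↔ IsOuterBiconnected D (insert x (Vset v i)) := by
  have h3 := hco.1
  constructor
  · rintro ⟨-, -, w, hwv, hw, hwco⟩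
    have hcard : i + 1 ≤ Fintype.card V := by
      have := ncard_lt_card (s := Vset v i) fun h ↦ hx (h ▸ mem_univ x)
      rwa [ncard_Vset hco.2.1, Nat.card_eq_fintype_card] at this
    rw [← Vset_extendSeq_succ, ← Vset_congr hwv le_rfl]
    exact isOuterBiconnected_Vset hw hwco (by omega) hcard
  · intro hxW
    obtain ⟨w, hwv, hw, hwco⟩ := hext
    have h1 := hwv 1 le_rfl (by omega)
    have h2 := hwv 2 (by omega) (by omega)
    have hout : D.OnOuterEdge univ s(v 1, v 2) := by
      have := (hwco.2.2.2 _ hwco.1 le_rfl).2.1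
      rwa [Vset_card_eq_univ hw, h1, h2] at this
    have hnew := hco.extendSeq hD hout hW hx hxW
    exact ⟨hx, hnew, hnew.extensibleOrd hD (by rwa [Vset_extendSeq_succ]) hw hwco
      (by rwa [extendSeq_of_le v x (by omega)]) (by rwa [extendSeq_of_le v x (by omega)])⟩

end Ordering

/-- Let `G` be an internally triangulated plane graph with an
extensible canonical ordering `v 1, …, v i` for `G_i`.  A vertex `x ∈ V \ V_i` is
eligible for `G_i` iff `R_i(x) ∩ V = ∅`, iff `R_i(x) ∩ 𝓔_i = ∅`. -/
theorem eligible_iff_region_empty {V : Type} [Fintype V]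
    (G : SimpleGraph V) (D : PlaneDrawing G)
    (hG : InternallyTriangulatedOn D Set.univ)
    (i : ℕ) (hin : i ≤ Fintype.card V) (v : ℕ → V)
    (hco : IsCanonicalOrdering D i v) (hext : ExtensibleOrd D i v)
    (x : V) (hx : x ∉ Vset v i) :
    (Eligible D i v x ↔ ∀ y : V, D.vert y ∉ Rregion D (Vset v i) x) ∧
    (Eligible D i v x ↔
      ∀ y : V, Eligible D i v y → D.vert y ∉ Rregion D (Vset v i) x) := by
  have h3 := hco.1
  have hD := hG.2
  obtain ⟨w, hwv, hw, hwco⟩ := id hext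
  have hW : IsOuterBiconnected D (Vset v i) := by
    rw [← Vset_congr hwv le_rfl]
    exact isOuterBiconnected_Vset hw hwco h3 hin
  have helig {y : V} (hy : y ∉ Vset v i) := eligible_iff_isOuterBiconnected hD hco hext hW hy
  have hempty : Eligible D i v x → ∀ y : V, D.vert y ∉ Rregion D (Vset v i) x := by
    intro hel y hyR
    have hxW := (helig hx).mp hel
    rw [D.vert_mem_Rregion_iff hW.2
      (hxW.1.not_subsingleton_nbrsIn hx (nontrivial_Vset hco.2.2.1 (by omega)))] at hyR
    exact hyR.2 (hxW.2 y hyR.1)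
  have hback : (∀ y : V, Eligible D i v y → D.vert y ∉ Rregion D (Vset v i) x) →
      Eligible D i v x := by
    intro hno
    by_cases hnbr : (nbrsIn G (Vset v i) x).Subsingleton
    · obtain ⟨y, hy, hyW⟩ := hW.exists_insert hD hw hwco
        (hwv 1 le_rfl (by omega) ▸ mem_Vset le_rfl (by omega))
        (hwv 2 (by omega) (by omega) ▸ mem_Vset (by omega) (by omega))
        fun h ↦ hx (h ▸ mem_univ x)
      refine absurd ?_ (hno y ((helig hy).mpr hyW))
      rw [Rregion, if_pos hnbr]
      exact hW.2 y hy
    · refine (helig hx).mpr (hW.insert hx hnbr (not_nonempty_iff_eq_empty.mp fun hhid ↦ ?_))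
      obtain ⟨y, hy, hynbr, hemp⟩ := D.exists_mem_hiddenBy_eq_empty hD hW.2 hx hhid
      have hyW : y ∉ Vset v i := fun h ↦ hy.1 (.inr h)
      exact hno y ((helig hyW).mpr (hW.insert hyW hynbr hemp))
        ((D.vert_mem_Rregion_iff hW.2 hnbr).mpr hy)
  exact ⟨⟨hempty, fun h ↦ hback fun y _ ↦ h y⟩, ⟨fun h y _ ↦ hempty h y, hback⟩⟩
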